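/- arXiv:1110.5870 — 5 statements merged into one kernel-verified Lean document; each statement's English description precedes it below -/
import Mathlib

section
/- There exist universal constants C > 0 and γ > 1 such that the following holds. Let Φ and Ψ be orthonormal bases of C^N with mutual coherence μ, let α ∈ C^N be an s-sparse vector, let l_1, ..., l_m be indices chosen independently and uniformly at random from {1, ..., N}, and let y = Φ*_Ω Ψ α ∈ C^m where Φ*_Ω is the m×N matrix whose rows are the rows of Φ* indexed by l_1, ..., l_m. If m ≥ C N μ² s log⁴(N), then with probability at least 1 − N^{−γ log³(N)} the vector α is the unique minimizer of the problem: minimize ‖β‖₁ over β ∈ C^N subject to y = Φ*_Ω Ψ β. -/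
open MeasureTheory Matrix
open scoped ENNReal

namespace Golf

open ComplexConjugate

/-- squared residual norm on `T` -/
noncomputable def Q {N : ℕ} (T : Finset (Fin N)) (w : Fin N → ℂ) : ℝ := ∑ j ∈ T, ‖w j‖ ^ 2

noncomputable def z {N : ℕ} (B : Fin N → Fin N → ℂ) (T : Finset (Fin N)) (w : Fin N → ℂ)
    (l : Fin N) : ℂ := ∑ j ∈ T, B l j * w j

/-- normalised residual -/
noncomputable def X {N : ℕ} (T : Finset (Fin N)) (A : ℝ) (w : Fin N → ℂ) : ℝ :=
  √(Q T w) * A / √(T.card : ℝ)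

noncomputable def eta {N : ℕ} (T : Finset (Fin N)) (K A : ℝ) (w : Fin N → ℂ) : ℝ :=
  1 / (K * T.card * max 1 (X T A w))

noncomputable def step {N : ℕ} (B : Fin N → Fin N → ℂ) (T : Finset (Fin N)) (K A : ℝ)
    (w : Fin N → ℂ) (l : Fin N) : Fin N → ℂ :=
  fun j => w j - (eta T K A w : ℂ) * (conj (B l j) * z B T w l)

noncomputable def run {N : ℕ} (f : (Fin N → ℂ) → Fin N → (Fin N → ℂ)) :
    (m : ℕ) → (Fin m → Fin N) → (Fin N → ℂ) → (Fin N → ℂ)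
  | 0, _, w => w
  | m + 1, ω, w => run f m (Fin.tail ω) (f w (ω 0))

lemma sum_run_le {N : ℕ} (f : (Fin N → ℂ) → Fin N → (Fin N → ℂ)) (G : (Fin N → ℂ) → ℝ) (c : ℝ)
    (hc : 0 ≤ c) (h : ∀ w, ∑ l, G (f w l) ≤ c * G w) (m : ℕ) :
    ∀ w, ∑ ω : Fin m → Fin N, G (run f m ω w) ≤ c ^ m * G w := by
  induction m with
  | zero => intro w; simp [run]
  | succ m ih =>
    intro w
    rw [← (Fin.consEquiv (fun _ : Fin (m+1) => Fin N)).sum_comp, Fintype.sum_prod_type]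
    simp only [run, Fin.consEquiv, Equiv.coe_fn_mk, Fin.cons_zero, Fin.tail_cons]
    calc _ ≤ ∑ l, c ^ m * G (f w l) := Finset.sum_le_sum fun l _ => ih _
      _ = c ^ m * ∑ l, G (f w l) := by rw [Finset.mul_sum]
      _ ≤ c ^ m * (c * G w) := by gcongr; exact h w
      _ = _ := by ring

lemma card_le_of_sum {ι : Type*} [Fintype ι] (G : ι → ℝ) (h0 : ∀ i, 0 ≤ G i) (t : ℝ)
    (S : Finset ι) (hS : ∀ i ∈ S, t ≤ G i) (M : ℝ) (hM : ∑ i, G i ≤ M) : S.card * t ≤ M := by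
  calc S.card * t = ∑ i ∈ S, t := by simp
    _ ≤ ∑ i ∈ S, G i := Finset.sum_le_sum hS
    _ ≤ ∑ i, G i := Finset.sum_le_sum_of_subset_of_nonneg (Finset.subset_univ _) fun i _ _ => h0 i
    _ ≤ M := hM

lemma run_inner {N : ℕ} (B : Fin N → Fin N → ℂ) (T : Finset (Fin N)) (K A : ℝ)
    (h : Fin N → ℂ) (m : ℕ) : ∀ (ω : Fin m → Fin N) (_ : ∀ i, ∑ j, B (ω i) j * h j = 0) (w),
    ∑ j, conj (run (step B T K A) m ω w j) * h j = ∑ j, conj (w j) * h j := by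
  induction m with
  | zero => intro ω _ w; rfl
  | succ m ih =>
    intro ω hω w
    rw [run, ih (Fin.tail ω) (fun i => hω i.succ)]
    have : ∑ j, conj (step B T K A w (ω 0) j) * h j = ∑ j, conj (w j) * h j
        - eta T K A w * conj (z B T w (ω 0)) * ∑ j, B (ω 0) j * h j := by
      rw [Finset.mul_sum, ← Finset.sum_sub_distrib]
      refine Finset.sum_congr rfl fun j _ => ?_
      simp [step]; ring
    rw [this, hω 0]; simp

lemma Q_nonneg {N : ℕ} (T : Finset (Fin N)) (w : Fin N → ℂ) : 0 ≤ Q T w :=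
  Finset.sum_nonneg fun _ _ => by positivity

lemma sum_z {N : ℕ} (B : Fin N → Fin N → ℂ) (T : Finset (Fin N)) (w : Fin N → ℂ)
    (hB : ∀ i j, ∑ l, conj (B l i) * B l j = if i = j then (N : ℂ) else 0) :
    ∑ l, ‖z B T w l‖ ^ 2 = N * Q T w := by
  have : ((∑ l, ‖z B T w l‖ ^ 2 : ℝ) : ℂ) = ((N * Q T w : ℝ) : ℂ) := by
    push_cast
    calc ∑ l, (‖z B T w l‖ : ℂ) ^ 2
        = ∑ l, ∑ i ∈ T, ∑ j ∈ T, conj (w i) * w j * (conj (B l i) * B l j) := by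
          refine Finset.sum_congr rfl fun l _ => ?_
          rw [← Complex.conj_mul', z, map_sum, Finset.sum_mul_sum]
          refine Finset.sum_congr rfl fun i _ => Finset.sum_congr rfl fun j _ => ?_
          simp; ring
      _ = ∑ i ∈ T, ∑ j ∈ T, conj (w i) * w j * ∑ l, (conj (B l i) * B l j) := by
          rw [Finset.sum_comm]
          refine Finset.sum_congr rfl fun i _ => ?_
          rw [Finset.sum_comm]
          simp only [Finset.mul_sum]
      _ = ∑ i ∈ T, conj (w i) * w i * N := by
          refine Finset.sum_congr rfl fun i hi => ?_
          simp [hB, hi]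
      _ = _ := by
          rw [Q]; push_cast; rw [Finset.mul_sum]
          refine Finset.sum_congr rfl fun i hi => ?_
          rw [Complex.conj_mul']; ring
  exact_mod_cast this

lemma sum_cross {N : ℕ} (B : Fin N → Fin N → ℂ) (T : Finset (Fin N)) (w : Fin N → ℂ)
    (hB : ∀ i j, ∑ l, conj (B l i) * B l j = if i = j then (N : ℂ) else 0) (j : Fin N)
    (hj : j ∉ T) : ∑ l, conj (B l j) * z B T w l = 0 := by
  calc _ = ∑ l, ∑ i ∈ T, w i * (conj (B l j) * B l i) := by
        refine Finset.sum_congr rfl fun l _ => ?_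
        rw [z, Finset.mul_sum]
        refine Finset.sum_congr rfl fun i _ => ?_
        ring
    _ = ∑ i ∈ T, w i * ∑ l, (conj (B l j) * B l i) := by
        rw [Finset.sum_comm]; simp only [Finset.mul_sum]
    _ = 0 := by
        refine Finset.sum_eq_zero fun i hi => ?_
        have : j ≠ i := fun h => hj (h ▸ hi)
        simp [hB, this]

lemma sum_B_le {N : ℕ} (B : Fin N → Fin N → ℂ) (T : Finset (Fin N)) (K : ℝ)
    (hK : ∀ l j, ‖B l j‖ ^ 2 ≤ K) (l : Fin N) : ∑ j ∈ T, ‖B l j‖ ^ 2 ≤ K * T.card := by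
  calc _ ≤ ∑ j ∈ T, K := Finset.sum_le_sum fun j _ => hK l j
    _ = _ := by simp; ring

lemma z_le {N : ℕ} (B : Fin N → Fin N → ℂ) (T : Finset (Fin N)) (K : ℝ)
    (hK : ∀ l j, ‖B l j‖ ^ 2 ≤ K) (w : Fin N → ℂ) (l : Fin N) :
    ‖z B T w l‖ ^ 2 ≤ K * T.card * Q T w := by
  have h1 : ‖z B T w l‖ ≤ ∑ j ∈ T, ‖B l j‖ * ‖w j‖ := by
    refine (norm_sum_le _ _).trans (le_of_eq ?_)
    simp
  calc ‖z B T w l‖ ^ 2 ≤ (∑ j ∈ T, ‖B l j‖ * ‖w j‖) ^ 2 := by gcongr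
    _ ≤ (∑ j ∈ T, ‖B l j‖ ^ 2) * ∑ j ∈ T, ‖w j‖ ^ 2 := Finset.sum_mul_sq_le_sq_mul_sq _ _ _
    _ ≤ _ := by
      have := Q_nonneg T w
      rw [← Q]; exact mul_le_mul_of_nonneg_right (sum_B_le B T K hK l) this

lemma Q_step {N : ℕ} (B : Fin N → Fin N → ℂ) (T : Finset (Fin N)) (K A : ℝ) (hK0 : 0 < K)
    (hT : 0 < T.card)
    (hK : ∀ l j, ‖B l j‖ ^ 2 ≤ K) (w : Fin N → ℂ) (l : Fin N) :
    Q T (step B T K A w l) ≤ Q T w - eta T K A w * ‖z B T w l‖ ^ 2 := by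
  have hT' : (0:ℝ) < T.card := by exact_mod_cast hT
  set e := eta T K A w with he
  have hM : 1 ≤ max 1 (X T A w) := le_max_left _ _
  have he0 : 0 ≤ e := by rw [he, eta]; positivity
  have he1 : e * (K * T.card) ≤ 1 := by
    rw [he, eta, div_mul_eq_mul_div, div_le_one (by positivity)]
    nlinarith [mul_pos hK0 hT']
  have key : Q T (step B T K A w l) = Q T w - 2 * e * ‖z B T w l‖ ^ 2
      + e ^ 2 * ‖z B T w l‖ ^ 2 * ∑ j ∈ T, ‖B l j‖ ^ 2 := by
    have : ((Q T (step B T K A w l) : ℝ) : ℂ) = ((Q T w - 2 * e * ‖z B T w l‖ ^ 2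
      + e ^ 2 * ‖z B T w l‖ ^ 2 * ∑ j ∈ T, ‖B l j‖ ^ 2 : ℝ) : ℂ) := by
      simp only [Q]
      push_cast
      simp only [← Complex.conj_mul', step]
      have hz : conj (z B T w l) * z B T w l = conj (z B T w l) * ∑ j ∈ T, B l j * w j := rfl
      have hz' : conj (z B T w l) * z B T w l =
        (∑ j ∈ T, conj (B l j) * conj (w j)) * z B T w l := by
          conv_lhs => rw [z, map_sum]
          simp [z]
      have e1 : 2 * (e:ℂ) * (conj (z B T w l) * z B T w l)
         = e * (conj (z B T w l) * ∑ j ∈ T, B l j * w j) +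
           e * ((∑ j ∈ T, conj (B l j) * conj (w j)) * z B T w l) := by
        rw [← hz', ← hz]; ring
      rw [e1, Finset.mul_sum, Finset.mul_sum, Finset.sum_mul, Finset.mul_sum, Finset.mul_sum,
        ← Finset.sum_add_distrib, ← Finset.sum_sub_distrib, ← Finset.sum_add_distrib]
      refine Finset.sum_congr rfl fun j _ => ?_
      simp only [map_sub, map_mul, Complex.conj_ofReal, Complex.conj_conj, ← he]
      ring
    exact_mod_cast this
  rw [key]
  have h1 := sum_B_le B T K hK l
  have h2 : e * ∑ j ∈ T, ‖B l j‖ ^ 2 ≤ 1 := le_trans (by gcongr) he1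
  have h3 : 0 ≤ e * ‖z B T w l‖ ^ 2 := by positivity
  nlinarith

lemma phi_aux (x x' ζ : ℝ) (hx : 0 ≤ x) (hx' : 0 ≤ x') (h0 : 0 ≤ ζ) (h1 : ζ ≤ 1)
    (h : x' ^ 2 ≤ x ^ 2 * (1 - ζ / max 1 x)) :
    x' * Real.exp x' ≤ x * Real.exp x * (1 - ζ / 4) := by
  have hM : 1 ≤ max 1 x := le_max_left _ _
  set t := ζ / max 1 x with ht
  have ht0 : 0 ≤ t := by positivity
  have ht1 : t ≤ 1 := by rw [ht, div_le_one (by positivity)]; linarith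
  have hle : x' ≤ x * (1 - t / 2) := by
    refine abs_le_of_sq_le_sq' ?_ (by nlinarith) |>.2
    nlinarith [mul_nonneg (sq_nonneg x) (sq_nonneg t)]
  have hxx : x' ≤ x := by nlinarith
  rcases le_total 1 x with hx1 | hx1
  · have : t * x = ζ := by rw [ht, max_eq_right hx1]; field_simp
    have h2 : x' ≤ x + -(ζ / 2) := by nlinarith
    have h3 : Real.exp (-(ζ / 2)) ≤ 1 - ζ / 4 := by
      rw [Real.exp_neg, inv_le_comm₀ (Real.exp_pos _) (by linarith)]
      refine le_trans ?_ (Real.add_one_le_exp _)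
      rw [inv_le_iff_one_le_mul₀ (by linarith)]
      nlinarith
    calc x' * Real.exp x' ≤ x * Real.exp (x + -(ζ / 2)) := by gcongr
      _ = x * Real.exp x * Real.exp (-(ζ/2)) := by rw [Real.exp_add]; ring
      _ ≤ _ := by gcongr
  · have : t = ζ := by rw [ht, max_eq_left hx1]; simp
    rw [this] at hle
    calc x' * Real.exp x' ≤ (x * (1 - ζ / 2)) * Real.exp x := by
          have : 0 ≤ x * (1 - ζ / 2) := hx'.trans hle
          gcongr
      _ ≤ x * Real.exp x * (1 - ζ / 4) := by
        have := mul_nonneg (mul_nonneg hx (Real.exp_pos x).le) h0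
        nlinarith

lemma pot1 {N : ℕ} (B : Fin N → Fin N → ℂ) (T : Finset (Fin N)) (K A : ℝ) (hK0 : 0 < K)
    (hA : 0 < A) (hT : 0 < T.card) (hK : ∀ l j, ‖B l j‖ ^ 2 ≤ K)
    (hB : ∀ i j, ∑ l, conj (B l i) * B l j = if i = j then (N : ℂ) else 0)
    (w : Fin N → ℂ) :
    ∑ l, (X T A (step B T K A w l) * Real.exp (X T A (step B T K A w l)))
      ≤ (N * Real.exp (-(1 / (4 * (K * T.card))))) * (X T A w * Real.exp (X T A w)) := by
  have hT' : (0:ℝ) < T.card := by exact_mod_cast hT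
  have hXn : ∀ v, 0 ≤ X T A v := fun v => by unfold X; positivity
  have hX2 : ∀ v, X T A v ^ 2 = Q T v * (A ^ 2 / T.card) := fun v => by
    unfold X
    rw [div_pow, mul_pow, Real.sq_sqrt (Q_nonneg T v), Real.sq_sqrt hT'.le]; ring
  have hc : 0 < A ^ 2 / T.card := by positivity
  have hM : 1 ≤ max 1 (X T A w) := le_max_left _ _
  have he0 : 0 ≤ eta T K A w := by unfold eta; positivity
  rcases (Q_nonneg T w).eq_or_lt with h0 | hQ
  · have : ∀ l, X T A (step B T K A w l) = 0 := fun l => by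
      have h1 := Q_step B T K A hK0 hT hK w l
      have h2 : Q T (step B T K A w l) = 0 := by
        refine le_antisymm ?_ (Q_nonneg _ _)
        have : 0 ≤ eta T K A w * ‖z B T w l‖ ^ 2 := by positivity
        linarith
      simp [X, h2]
    simp only [this, zero_mul, Finset.sum_const_zero]
    have := hXn w
    positivity
  have hpt : ∀ l, X T A (step B T K A w l) * Real.exp (X T A (step B T K A w l)) ≤
      X T A w * Real.exp (X T A w) * (1 - (‖z B T w l‖ ^ 2 / (K * T.card * Q T w)) / 4) := by
    intro l
    refine phi_aux _ _ _ (hXn _) (hXn _) (by positivity) ?_ ?_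
    · rw [div_le_one (by positivity)]; exact z_le B T K hK w l
    · rw [hX2, hX2]
      have h1 := Q_step B T K A hK0 hT hK w l
      have h2 : Q T w * (1 - ‖z B T w l‖ ^ 2 / (K * T.card * Q T w) / max 1 (X T A w))
         = Q T w - eta T K A w * ‖z B T w l‖ ^ 2 := by
        unfold eta; field_simp
      calc _ ≤ (Q T w - eta T K A w * ‖z B T w l‖ ^ 2) * (A ^ 2 / T.card) := by gcongr
        _ = _ := by rw [← h2]; ring
  refine (Finset.sum_le_sum fun l _ => hpt l).trans ?_
  rw [← Finset.mul_sum, mul_comm]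
  have : ∑ l, (1 - (‖z B T w l‖ ^ 2 / (K * T.card * Q T w)) / 4) =
      N * (1 - 1 / (4 * (K * T.card))) := by
    rw [Finset.sum_sub_distrib, ← Finset.sum_div, ← Finset.sum_div, sum_z B T w hB]
    simp; field_simp
  rw [this]
  have := hXn w
  gcongr
  have := Real.add_one_le_exp (-(1 / (4 * (K * (T.card:ℝ)))))
  linarith

lemma exp_le_quad (x : ℝ) (h : |x| ≤ 1) : Real.exp x ≤ 1 + x + x ^ 2 := by
  have := Real.abs_exp_sub_one_sub_id_le h
  linarith [(abs_le.1 this).2]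

lemma pot2 {N : ℕ} (B : Fin N → Fin N → ℂ) (T : Finset (Fin N)) (K A ε : ℝ) (hK0 : 0 < K)
    (hA : 0 < A) (hε : 0 < ε) (hε1 : ε ≤ 1) (hT : 0 < T.card) (hK : ∀ l j, ‖B l j‖ ^ 2 ≤ K)
    (hB : ∀ i j, ∑ l, conj (B l i) * B l j = if i = j then (N : ℂ) else 0)
    (j : Fin N) (hj : j ∉ T) (θ : ℂ) (hθ : ‖θ‖ = 1) (w : Fin N → ℂ) :
    ∑ l, Real.exp (ε * A * (θ * step B T K A w l j).re)
      ≤ (N * Real.exp (ε ^ 2 / (K * T.card))) * Real.exp (ε * A * (θ * w j).re) := by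
  have hT' : (0:ℝ) < T.card := by exact_mod_cast hT
  have hM : 1 ≤ max 1 (X T A w) := le_max_left _ _
  set e := eta T K A w with he
  have he0 : 0 ≤ e := by rw [he]; unfold eta; positivity
  have heQ : (A * e) ^ 2 * (K * T.card * Q T w) * K ≤ 1 := by
    have h1 : X T A w ≤ max 1 (X T A w) := le_max_right _ _
    have hx0 : 0 ≤ X T A w := by unfold X; positivity
    have h2 : X T A w ^ 2 ≤ max 1 (X T A w) ^ 2 := by gcongr
    have h3 : A ^ 2 * Q T w = X T A w ^ 2 * T.card := by
      unfold X
      rw [div_pow, mul_pow, Real.sq_sqrt (Q_nonneg T w), Real.sq_sqrt hT'.le]; field_simp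
    have h4 : (A * e) ^ 2 * (K * T.card * Q T w) * K =
        X T A w ^ 2 / max 1 (X T A w) ^ 2 := by
      calc _ = (A ^ 2 * Q T w) * (e ^ 2 * K ^ 2 * T.card) := by ring
        _ = _ := by rw [h3, he]; unfold eta; field_simp
    rw [h4, div_le_one (by positivity)]; exact h2
  set Y : Fin N → ℝ := fun l => -(ε * A * e) * (θ * (conj (B l j) * z B T w l)).re with hY
  have hstep : ∀ l, ε * A * (θ * step B T K A w l j).re = ε * A * (θ * w j).re + Y l := by
    intro l
    have : θ * step B T K A w l j = θ * w j - (e : ℂ) * (θ * (conj (B l j) * z B T w l)) := by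
      simp only [step]; rw [← he]; ring
    rw [this, Complex.sub_re, Complex.re_ofReal_mul]; simp only [hY]; ring
  have hY2 : ∀ l, Y l ^ 2 ≤ ε ^ 2 * (A * e) ^ 2 * K * ‖z B T w l‖ ^ 2 := by
    intro l
    have h1 : (θ * (conj (B l j) * z B T w l)).re ^ 2 ≤ K * ‖z B T w l‖ ^ 2 := by
      calc _ = |(θ * (conj (B l j) * z B T w l)).re| ^ 2 := (sq_abs _).symm
        _ ≤ ‖θ * (conj (B l j) * z B T w l)‖ ^ 2 := by gcongr; exact Complex.abs_re_le_norm _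
        _ = ‖B l j‖ ^ 2 * ‖z B T w l‖ ^ 2 := by simp [hθ, mul_pow]
        _ ≤ _ := by gcongr; exact hK l j
    calc Y l ^ 2 = (ε * A * e) ^ 2 * (θ * (conj (B l j) * z B T w l)).re ^ 2 := by
          simp only [hY]; ring
      _ ≤ (ε * A * e) ^ 2 * (K * ‖z B T w l‖ ^ 2) := by gcongr
      _ = _ := by ring
  have hY1 : ∀ l, |Y l| ≤ 1 := by
    intro l
    have h1 := hY2 l
    have h2 : ε ^ 2 * (A * e) ^ 2 * K * ‖z B T w l‖ ^ 2 ≤ 1 := by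
      calc _ ≤ ε ^ 2 * (A * e) ^ 2 * K * (K * T.card * Q T w) := by gcongr; exact z_le B T K hK w l
        _ = ε ^ 2 * ((A * e) ^ 2 * (K * T.card * Q T w) * K) := by ring
        _ ≤ 1 ^ 2 * 1 := by
          have := Q_nonneg T w
          gcongr
        _ = 1 := by norm_num
    exact abs_le_one_iff_mul_self_le_one.2 (by nlinarith)
  have hsumY : ∑ l, Y l = 0 := by
    simp only [hY]
    rw [← Finset.mul_sum, ← Complex.re_sum, ← Finset.mul_sum, sum_cross B T w hB j hj]; simp
  have hsumY2 : ∑ l, Y l ^ 2 ≤ N * (ε ^ 2 / (K * T.card)) := by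
    calc _ ≤ ∑ l, ε ^ 2 * (A * e) ^ 2 * K * ‖z B T w l‖ ^ 2 := Finset.sum_le_sum fun l _ => hY2 l
      _ = ((A * e) ^ 2 * (K * T.card * Q T w) * K) * (N * (ε ^ 2 / (K * T.card))) := by
        rw [← Finset.mul_sum, sum_z B T w hB]; field_simp
      _ ≤ 1 * (N * (ε ^ 2 / (K * T.card))) := by gcongr
      _ = _ := one_mul _
  simp only [hstep, Real.exp_add]
  rw [← Finset.mul_sum, mul_comm]
  gcongr
  calc ∑ l, Real.exp (Y l) ≤ ∑ l, (1 + Y l + Y l ^ 2) :=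
        Finset.sum_le_sum fun l _ => exp_le_quad _ (hY1 l)
    _ ≤ N + 0 + N * (ε ^ 2 / (K * T.card)) := by
        rw [Finset.sum_add_distrib, Finset.sum_add_distrib, hsumY]; simpa using hsumY2
    _ = N * (ε ^ 2 / (K * T.card) + 1) := by ring
    _ ≤ _ := by gcongr; exact Real.add_one_le_exp _


lemma bad1 {N : ℕ} (hN : 0 < N) (B : Fin N → Fin N → ℂ) (T : Finset (Fin N)) (K A : ℝ)
    (hK0 : 0 < K)
    (hA : 0 < A) (hT : 0 < T.card) (hK : ∀ l j, ‖B l j‖ ^ 2 ≤ K)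
    (hB : ∀ i j, ∑ l, conj (B l i) * B l j = if i = j then (N : ℂ) else 0)
    (w : Fin N → ℂ) (hw : Q T w ≤ T.card) (m : ℕ) (S : Finset (Fin m → Fin N))
    (hS : ∀ ω ∈ S, 1 / (4 * N) < √(Q T (run (step B T K A) m ω w))) :
    (S.card : ℝ) ≤ N ^ m * (4 * N ^ 2 * Real.exp (A - m / (K * T.card) / 4)) := by
  have hT' : (0:ℝ) < T.card := by exact_mod_cast hT
  have hN' : (0:ℝ) < N := by exact_mod_cast hN
  have hN1 : (1:ℝ) ≤ N := by exact_mod_cast hN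
  have hTN : (T.card : ℝ) ≤ N := by
    have := T.card_le_univ
    simp at this; exact_mod_cast this
  have hXn : ∀ v, 0 ≤ X T A v := fun v => by unfold X; positivity
  have hsum := sum_run_le (step B T K A) (fun v => X T A v * Real.exp (X T A v))
    (N * Real.exp (-(1 / (4 * (K * T.card))))) (by positivity)
    (pot1 B T K A hK0 hA hT hK hB) m w
  have hXw : X T A w ≤ A := by
    unfold X
    rw [div_le_iff₀ (by positivity), mul_comm]
    gcongr
  have h1 := card_le_of_sum (fun ω : Fin m → Fin N => X T A (run (step B T K A) m ω w)
      * Real.exp (X T A (run (step B T K A) m ω w)))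
    (fun ω => mul_nonneg (hXn _) (Real.exp_pos _).le)
    (A / (4 * N * √(T.card : ℝ))) S ?_ _ hsum
  · have h2 : √(T.card : ℝ) ≤ N := by
      rw [Real.sqrt_le_left hN'.le]; nlinarith
    have h3 : ((N:ℝ) * Real.exp (-(1 / (4 * (K * T.card))))) ^ m * (X T A w * Real.exp (X T A w))
      ≤ N ^ m * (A * Real.exp (A - m / (K * T.card) / 4)) := by
      have : (A - m / (K * T.card) / 4) = m * (-(1 / (4 * (K * T.card)))) + A := by
        field_simp; ring
      rw [mul_pow, ← Real.exp_nat_mul, this, Real.exp_add, mul_assoc]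
      have h5 : X T A w * Real.exp (X T A w) ≤ A * Real.exp A := by
        have := hXn w
        gcongr
      calc _ ≤ (N:ℝ) ^ m * (Real.exp (m * (-(1 / (4 * (K * T.card))))) * (A * Real.exp A)) := by
            gcongr
        _ = _ := by ring
    have h4 : (S.card : ℝ) * (A / (4 * N * √(T.card : ℝ))) ≤
      N ^ m * (A * Real.exp (A - m / (K * T.card) / 4)) := h1.trans h3
    rw [← mul_div_assoc, div_le_iff₀ (by positivity)] at h4
    have h6 : (S.card : ℝ) ≤
        N ^ m * Real.exp (A - m / (K * T.card) / 4) * (4 * N * √(T.card : ℝ)) := by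
      refine le_of_mul_le_mul_right ?_ hA
      linarith
    calc _ ≤ _ := h6
      _ ≤ N ^ m * Real.exp (A - m / (K * T.card) / 4) * (4 * N * N) := by gcongr
      _ = _ := by ring
  · intro ω hω
    have h2 := hS ω hω
    have h3 : A / (4 * N * √(T.card : ℝ)) ≤ X T A (run (step B T K A) m ω w) := by
      unfold X
      calc A / (4 * N * √(T.card : ℝ)) = (1 / (4 * N)) * A / √(T.card : ℝ) := by field_simp
        _ ≤ _ := by gcongr
    have h4 := Real.one_le_exp (hXn (run (step B T K A) m ω w))
    calc _ ≤ _ := h3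
      _ ≤ _ := le_mul_of_one_le_right (hXn _) h4

lemma bad2 {N : ℕ} (B : Fin N → Fin N → ℂ) (T : Finset (Fin N)) (K A ε : ℝ) (hK0 : 0 < K)
    (hA : 0 < A) (hε : 0 < ε) (hε1 : ε ≤ 1) (hT : 0 < T.card) (hK : ∀ l j, ‖B l j‖ ^ 2 ≤ K)
    (hB : ∀ i j, ∑ l, conj (B l i) * B l j = if i = j then (N : ℂ) else 0)
    (j : Fin N) (hj : j ∉ T) (θ : ℂ) (hθ : ‖θ‖ = 1) (w : Fin N → ℂ) (hw : w j = 0)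
    (m : ℕ) (S : Finset (Fin m → Fin N))
    (hS : ∀ ω ∈ S, 1 / 4 < (θ * run (step B T K A) m ω w j).re) :
    (S.card : ℝ) ≤ N ^ m * Real.exp (ε ^ 2 * (m / (K * T.card)) - ε * A / 4) := by
  have hsum := sum_run_le (step B T K A) (fun v => Real.exp (ε * A * (θ * v j).re))
    (N * Real.exp (ε ^ 2 / (K * T.card))) (by positivity)
    (pot2 B T K A ε hK0 hA hε hε1 hT hK hB j hj θ hθ) m w
  have h1 := card_le_of_sum
    (fun ω : Fin m → Fin N => Real.exp (ε * A * (θ * run (step B T K A) m ω w j).re))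
    (fun ω => (Real.exp_pos _).le) (Real.exp (ε * A / 4)) S ?_ _ hsum
  · rw [Real.exp_sub, ← mul_div_assoc, le_div_iff₀ (Real.exp_pos _)]
    refine h1.trans (le_of_eq ?_)
    rw [mul_pow, ← Real.exp_nat_mul, hw]
    simp only [mul_zero, Complex.zero_re, Real.exp_zero, mul_one]
    congr 2; ring
  · intro ω hω
    have := hS ω hω
    have h2 : 0 < ε * A := by positivity
    gcongr
    nlinarith

/-- the good event for a starting vector -/
def Good {N : ℕ} (B : Fin N → Fin N → ℂ) (T : Finset (Fin N)) (K A : ℝ) {m : ℕ}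
    (w : Fin N → ℂ) (ω : Fin m → Fin N) : Prop :=
  √(Q T (run (step B T K A) m ω w)) ≤ 1 / (4 * N) ∧
    ∀ j ∉ T, ‖run (step B T K A) m ω w j‖ ≤ 1 / 2

lemma norm_of_re (c : ℂ) (h1 : (1 * c).re ≤ 1 / 4) (h2 : (-1 * c).re ≤ 1 / 4)
    (h3 : (Complex.I * c).re ≤ 1 / 4) (h4 : (-Complex.I * c).re ≤ 1 / 4) : ‖c‖ ≤ 1 / 2 := by
  refine (Complex.norm_le_abs_re_add_abs_im c).trans ?_
  simp at h1 h2 h3 h4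
  have := abs_le.2 ⟨by linarith, h1⟩
  have := abs_le.2 ⟨by linarith, h4⟩
  norm_num at *
  linarith

open Classical in
lemma good_card {N : ℕ} (hN : 0 < N) (B : Fin N → Fin N → ℂ) (T : Finset (Fin N)) (K L : ℝ)
    (hK0 : 0 < K)
    (hL : 0 < L) (hT : 0 < T.card) (hK : ∀ l j, ‖B l j‖ ^ 2 ≤ K)
    (hB : ∀ i j, ∑ l, conj (B l i) * B l j = if i = j then (N : ℂ) else 0)
    (w : Fin N → ℂ) (hw : Q T w ≤ T.card) (hw0 : ∀ j ∉ T, w j = 0) (m : ℕ)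
    (hm : L = m / (K * T.card)) :
    ((Finset.univ.filter fun ω : Fin m → Fin N => ¬ Good B T K (L / 8) w ω).card : ℝ)
      ≤ N ^ m * (8 * N ^ 2 * Real.exp (-(L / 4096))) := by
  have hN1 : (1:ℝ) ≤ N := by exact_mod_cast hN
  set r := fun ω : Fin m → Fin N => run (step B T K (L / 8)) m ω w with hr
  set S1 := Finset.univ.filter fun ω : Fin m → Fin N => 1 / (4 * (N:ℝ)) < √(Q T (r ω)) with hS1
  set Θ : Finset ℂ := {1, -1, Complex.I, -Complex.I} with hΘ
  have hΘn : ∀ θ ∈ Θ, ‖θ‖ = 1 := by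
    intro θ hθ
    simp [hΘ] at hθ
    rcases hθ with h | h | h | h <;> simp [h]
  have hΘc : Θ.card ≤ 4 := Finset.card_le_four
  set S2 : ℂ → Fin N → Finset (Fin m → Fin N) := fun θ j =>
    Finset.univ.filter fun ω : Fin m → Fin N => 1 / 4 < (θ * r ω j).re with hS2
  have hsub : (Finset.univ.filter fun ω : Fin m → Fin N => ¬ Good B T K (L / 8) w ω) ⊆
      S1 ∪ Θ.biUnion fun θ => (Finset.univ \ T).biUnion fun j => S2 θ j := by
    intro ω hω
    by_contra hcon
    simp only [Finset.mem_union, Finset.mem_biUnion, not_or, not_exists, not_and, hS1, hS2,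
      Finset.mem_filter, Finset.mem_univ, true_and, not_lt, Finset.mem_sdiff] at hcon hω
    refine hω ⟨hcon.1, fun j hj => norm_of_re _ ?_ ?_ ?_ ?_⟩
    · exact hcon.2 1 (by simp [hΘ]) j hj
    · exact hcon.2 (-1) (by simp [hΘ]) j hj
    · exact hcon.2 Complex.I (by simp [hΘ]) j hj
    · exact hcon.2 (-Complex.I) (by simp [hΘ]) j hj
  have hb1 : (S1.card : ℝ) ≤ N ^ m * (4 * N ^ 2 * Real.exp (-(L / 4096))) := by
    refine (bad1 hN B T K (L / 8) hK0 (by positivity) hT hK hB w hw m S1 ?_).trans ?_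
    · intro ω hω; exact (Finset.mem_filter.1 hω).2
    · rw [← hm]; gcongr; linarith
  have hb2 : ∀ θ ∈ Θ, ∀ j ∈ Finset.univ \ T, ((S2 θ j).card : ℝ) ≤
      N ^ m * Real.exp (-(L / 4096)) := by
    intro θ hθ j hj
    have hj : j ∉ T := by simpa using hj
    refine (bad2 B T K (L / 8) (1 / 64) hK0 (by positivity) (by norm_num) (by norm_num) hT hK hB
      j hj θ (hΘn θ hθ) w (hw0 j hj) m _ ?_).trans ?_
    · intro ω hω; exact (Finset.mem_filter.1 hω).2
    · rw [← hm]; gcongr; linarith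
  have hb3 : ((Θ.biUnion fun θ => (Finset.univ \ T).biUnion fun j => S2 θ j).card : ℝ) ≤
      4 * (N * (N ^ m * Real.exp (-(L / 4096)))) := by
    calc ((Θ.biUnion fun θ => (Finset.univ \ T).biUnion fun j => S2 θ j).card : ℝ)
        ≤ ∑ θ ∈ Θ, (((Finset.univ \ T).biUnion fun j => S2 θ j).card : ℝ) := by
          exact_mod_cast Finset.card_biUnion_le
      _ ≤ ∑ θ ∈ Θ, ∑ j ∈ Finset.univ \ T, ((S2 θ j).card : ℝ) := by
          refine Finset.sum_le_sum fun θ _ => ?_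
          exact_mod_cast Finset.card_biUnion_le
      _ ≤ ∑ θ ∈ Θ, ∑ j ∈ Finset.univ \ T, (N ^ m * Real.exp (-(L / 4096))) :=
          Finset.sum_le_sum fun θ hθ => Finset.sum_le_sum fun j hj => hb2 θ hθ j hj
      _ = Θ.card * (((Finset.univ \ T).card : ℝ) * (N ^ m * Real.exp (-(L / 4096)))) := by
          simp only [Finset.sum_const, nsmul_eq_mul]
      _ ≤ _ := by
          gcongr
          · exact_mod_cast hΘc
          · have := (Finset.univ \ T).card_le_univ
            simpa using this
  calc _ ≤ ((S1 ∪ Θ.biUnion fun θ => (Finset.univ \ T).biUnion fun j => S2 θ j).card : ℝ) := by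
        exact_mod_cast Finset.card_le_card hsub
    _ ≤ (S1.card : ℝ) + (Θ.biUnion fun θ => (Finset.univ \ T).biUnion fun j => S2 θ j).card := by
        exact_mod_cast Finset.card_union_le _ _
    _ ≤ N ^ m * (4 * N ^ 2 * Real.exp (-(L / 4096))) +
        4 * (N * (N ^ m * Real.exp (-(L / 4096)))) := add_le_add hb1 hb3
    _ ≤ _ := by
        have h : (N:ℝ) ≤ N ^ 2 := by nlinarith
        have h2 : 0 ≤ (N:ℝ) ^ m * Real.exp (-(L / 4096)) := by positivity
        nlinarith

/-- the pairing estimate on the good event -/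
lemma good_inner {N : ℕ} (B : Fin N → Fin N → ℂ) (T : Finset (Fin N)) (K A : ℝ) {m : ℕ}
    (w : Fin N → ℂ) (ω : Fin m → Fin N) (hg : Good B T K A w ω) (h : Fin N → ℂ)
    (hh : ∀ i, ∑ j, B (ω i) j * h j = 0) :
    ‖∑ j, conj (w j) * h j‖ ≤ 1 / (4 * N) * ∑ j ∈ T, ‖h j‖ + 1 / 2 * ∑ j ∈ Tᶜ, ‖h j‖ := by
  rw [← run_inner B T K A h m ω hh w]
  refine (norm_sum_le _ _).trans ?_
  rw [← Finset.sum_add_sum_compl T, Finset.mul_sum, Finset.mul_sum]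
  refine add_le_add (Finset.sum_le_sum fun j hj => ?_) (Finset.sum_le_sum fun j hj => ?_)
  · rw [norm_mul, RCLike.norm_conj]
    gcongr
    refine le_trans (Real.le_sqrt_of_sq_le ?_) hg.1
    exact Finset.single_le_sum (f := fun j => ‖run (step B T K A) m ω w j‖ ^ 2)
      (fun _ _ => by positivity) hj
  · rw [norm_mul, RCLike.norm_conj]
    gcongr
    exact hg.2 j (by simpa using hj)

noncomputable def sg {N : ℕ} (α : Fin N → ℂ) : Fin N → ℂ := fun j => α j / ‖α j‖

lemma recover {N : ℕ} (hN : 0 < N) (B : Fin N → Fin N → ℂ) (T : Finset (Fin N)) (K A : ℝ) {m : ℕ}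
    (α : Fin N → ℂ) (hα : ∀ j, j ∈ T ↔ α j ≠ 0)
    (ω : Fin m → Fin N) (hg : Good B T K A (sg α) ω)
    (hg' : ∀ j ∈ T, Good B T K A (Pi.single j 1) ω) (β : Fin N → ℂ)
    (hh : ∀ i, ∑ j, B (ω i) j * (β j - α j) = 0) (hne : β ≠ α) :
    ∑ i, ‖α i‖ < ∑ i, ‖β i‖ := by
  have hN1 : (1:ℝ) ≤ N := by exact_mod_cast hN
  have hTN : (T.card : ℝ) ≤ N := by
    have := T.card_le_univ
    simp at this; exact_mod_cast this
  set h : Fin N → ℂ := fun j => β j - α j with hdef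
  set a := ∑ j ∈ T, ‖h j‖ with ha
  set b := ∑ j ∈ Tᶜ, ‖h j‖ with hb
  have ha0 : 0 ≤ a := Finset.sum_nonneg fun _ _ => norm_nonneg _
  have hb0 : 0 ≤ b := Finset.sum_nonneg fun _ _ => norm_nonneg _
  have h1 : ∀ j ∈ T, ‖h j‖ ≤ 1 / (4 * N) * a + 1 / 2 * b := by
    intro j hj
    have := good_inner B T K A _ ω (hg' j hj) h hh
    have e : ∑ i, conj ((Pi.single j 1 : Fin N → ℂ) i) * h i = h j := by
      rw [Finset.sum_eq_single j]
      · simp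
      · intro i _ hi; simp [hi]
      · simp
    rwa [e] at this
  have h2 : a ≤ N * (1 / (4 * N) * a + 1 / 2 * b) := by
    calc a ≤ ∑ j ∈ T, (1 / (4 * N) * a + 1 / 2 * b) := Finset.sum_le_sum h1
      _ = T.card * (1 / (4 * N) * a + 1 / 2 * b) := by rw [Finset.sum_const, nsmul_eq_mul]
      _ ≤ _ := by gcongr
  have h3 : N * (1 / (4 * N) * a + 1 / 2 * b) = a / 4 + N * b / 2 := by field_simp
  have h4 : 1 / (4 * N) * a ≤ b / 4 := by
    rw [div_mul_eq_mul_div, div_le_iff₀ (by positivity)]; nlinarith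
  have h5 := good_inner B T K A _ ω hg h hh
  rw [← ha, ← hb] at h5
  have hbpos : 0 < b := by
    rcases hb0.eq_or_lt with hb' | hb'
    · exfalso
      have ha' : a = 0 := by
        rw [← hb'] at h2 h3
        nlinarith
      apply hne
      funext j
      have hj : ‖h j‖ = 0 := by
        by_cases hj : j ∈ T
        · exact (Finset.sum_eq_zero_iff_of_nonneg (fun _ _ => norm_nonneg _)).1 ha' j hj
        · exact (Finset.sum_eq_zero_iff_of_nonneg (fun _ _ => norm_nonneg _)).1 hb'.symm j
            (by simpa using hj)
      exact sub_eq_zero.1 (norm_eq_zero.1 hj)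
    · exact hb'
  have h6 : ∀ j, ‖α j‖ + (conj (sg α j) * h j).re + (if j ∈ T then 0 else ‖h j‖) ≤ ‖β j‖ := by
    intro j
    by_cases hj : j ∈ T
    · have hαj := (hα j).1 hj
      have hn : ‖sg α j‖ = 1 := by simp [sg, hαj]
      have e : conj (sg α j) * α j = (‖α j‖ : ℂ) := by
        have : (‖α j‖ : ℂ) ≠ 0 := by simpa using hαj
        simp only [sg, map_div₀, Complex.conj_ofReal]
        rw [div_mul_eq_mul_div, Complex.conj_mul', div_eq_iff this]; ring
      have e2 : ‖α j‖ + (conj (sg α j) * h j).re = (conj (sg α j) * β j).re := by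
        simp only [hdef, mul_sub, e, Complex.sub_re, Complex.ofReal_re]; ring
      simp only [hj, if_true, add_zero, e2]
      refine (Complex.re_le_norm _).trans ?_
      simp [hn]
    · have hαj : α j = 0 := by
        by_contra hc; exact hj ((hα j).2 hc)
      simp [hj, sg, hαj, hdef]
  have h7 : ∑ j, ‖α j‖ + (∑ j, conj (sg α j) * h j).re + b ≤ ∑ j, ‖β j‖ := by
    calc _ = ∑ j, (‖α j‖ + (conj (sg α j) * h j).re + (if j ∈ T then 0 else ‖h j‖)) := by
          rw [Finset.sum_add_distrib, Finset.sum_add_distrib, Complex.re_sum]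
          congr 1
          rw [hb, ← Finset.sum_add_sum_compl T (fun j => if j ∈ T then 0 else ‖h j‖)]
          have h0 : ∑ j ∈ T, (if j ∈ T then 0 else ‖h j‖) = 0 :=
            Finset.sum_eq_zero (fun j hj => by simp [hj])
          rw [h0, zero_add]
          exact Finset.sum_congr rfl fun j hj => by simp at hj; simp [hj]
      _ ≤ _ := Finset.sum_le_sum fun j _ => h6 j
  have h8 := Complex.abs_re_le_norm (∑ j, conj (sg α j) * h j)
  have h9 := neg_abs_le (∑ j, conj (sg α j) * h j).re
  linarith

open Classical in
lemma main_count {N : ℕ} (hN : 2 ≤ N) (B : Fin N → Fin N → ℂ) (T : Finset (Fin N)) (K : ℝ)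
    (hK0 : 0 < K) (hT : 0 < T.card) (hK : ∀ l j, ‖B l j‖ ^ 2 ≤ K)
    (hB : ∀ i j, ∑ l, conj (B l i) * B l j = if i = j then (N : ℂ) else 0)
    (α : Fin N → ℂ) (hα : ∀ j, j ∈ T ↔ α j ≠ 0) (m : ℕ)
    (hm : 4096 * 58 * K * T.card * Real.log N ^ 4 ≤ m) :
    ((Finset.univ.filter fun ω : Fin m → Fin N => ¬ ∀ β : Fin N → ℂ,
      (∀ i, ∑ j, B (ω i) j * (β j - α j) = 0) → β ≠ α → ∑ i, ‖α i‖ < ∑ i, ‖β i‖).card : ℝ)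
      ≤ N ^ m * (N : ℝ) ^ (-(2 * Real.log N ^ 3)) := by
  have hT' : (0:ℝ) < T.card := by exact_mod_cast hT
  have hN2 : (2:ℝ) ≤ N := by exact_mod_cast hN
  have hN0 : 0 < N := by omega
  have hTN : (T.card : ℝ) ≤ N := by
    have := T.card_le_univ
    simp at this; exact_mod_cast this
  have hlog : 1 / 2 ≤ Real.log N := by
    have := Real.log_two_gt_d9
    have := Real.log_le_log (by norm_num) hN2
    linarith
  set L : ℝ := m / (K * T.card) with hL
  have hL1 : 4096 * 58 * Real.log N ^ 4 ≤ L := by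
    rw [hL, le_div_iff₀ (by positivity)]; linarith
  have hL0 : 0 < L := lt_of_lt_of_le (by positivity) hL1
  set E := N ^ m * (8 * N ^ 2 * Real.exp (-(L / 4096))) with hE
  have hsg : ∀ j, ‖sg α j‖ ^ 2 ≤ 1 := by
    intro j
    by_cases hj : α j = 0 <;> simp [sg, hj]
  have g1 := good_card hN0 B T K L hK0 hL0 hT hK hB (sg α)
    (by
      calc Q T (sg α) ≤ ∑ j ∈ T, 1 := Finset.sum_le_sum fun j _ => hsg j
        _ = _ := by simp)
    (by
      intro j hj
      have : α j = 0 := by by_contra hc; exact hj ((hα j).2 hc)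
      simp [sg, this]) m rfl
  have g2 : ∀ j ∈ T, ((Finset.univ.filter fun ω : Fin m → Fin N =>
      ¬ Good B T K (L / 8) (Pi.single j 1) ω).card : ℝ) ≤ E := by
    intro j hj
    refine good_card hN0 B T K L hK0 hL0 hT hK hB (Pi.single j 1) ?_ ?_ m rfl
    · calc Q T (Pi.single j 1) ≤ ∑ j ∈ T, 1 := by
            refine Finset.sum_le_sum fun i _ => ?_
            by_cases h : i = j
            · subst h; simp
            · simp [h]
        _ = _ := by simp
    · intro i hi
      have : i ≠ j := fun h => hi (h ▸ hj)
      simp [this]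
  have hsub : (Finset.univ.filter fun ω : Fin m → Fin N => ¬ ∀ β : Fin N → ℂ,
      (∀ i, ∑ j, B (ω i) j * (β j - α j) = 0) → β ≠ α → ∑ i, ‖α i‖ < ∑ i, ‖β i‖) ⊆
      (Finset.univ.filter fun ω : Fin m → Fin N => ¬ Good B T K (L / 8) (sg α) ω) ∪
      T.biUnion fun j => (Finset.univ.filter fun ω : Fin m → Fin N =>
      ¬ Good B T K (L / 8) (Pi.single j 1) ω) := by
    intro ω hω
    by_contra hcon
    simp only [Finset.mem_union, Finset.mem_biUnion, not_or, not_exists, not_and,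
      Finset.mem_filter, Finset.mem_univ, true_and, not_not] at hcon hω
    exact hω fun β h1 h2 => recover hN0 B T K (L / 8) α hα ω hcon.1 hcon.2 β h1 h2
  have hE0 : 0 ≤ E := by positivity
  have hcard : ((Finset.univ.filter fun ω : Fin m → Fin N => ¬ ∀ β : Fin N → ℂ,
      (∀ i, ∑ j, B (ω i) j * (β j - α j) = 0) → β ≠ α → ∑ i, ‖α i‖ < ∑ i, ‖β i‖).card : ℝ)
      ≤ E + N * E := by
    calc _ ≤ (((Finset.univ.filter fun ω : Fin m → Fin N => ¬ Good B T K (L / 8) (sg α) ω) ∪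
      T.biUnion fun j => (Finset.univ.filter fun ω : Fin m → Fin N =>
      ¬ Good B T K (L / 8) (Pi.single j 1) ω)).card : ℝ) := by
          exact_mod_cast Finset.card_le_card hsub
      _ ≤ ((Finset.univ.filter fun ω : Fin m → Fin N => ¬ Good B T K (L / 8) (sg α) ω).card : ℝ) +
        (T.biUnion fun j => (Finset.univ.filter fun ω : Fin m → Fin N =>
        ¬ Good B T K (L / 8) (Pi.single j 1) ω)).card := by
          exact_mod_cast Finset.card_union_le _ _
      _ ≤ E + ∑ j ∈ T, ((Finset.univ.filter fun ω : Fin m → Fin N =>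
        ¬ Good B T K (L / 8) (Pi.single j 1) ω).card : ℝ) := by
          refine add_le_add g1 ?_
          exact_mod_cast Finset.card_biUnion_le
      _ ≤ E + ∑ j ∈ T, E := by gcongr with j hj; exact g2 j hj
      _ = E + T.card * E := by simp
      _ ≤ _ := by gcongr
  refine hcard.trans ?_
  have hNpos : (0:ℝ) < N := by linarith
  have e1 : (N : ℝ) ^ (-(2 * Real.log N ^ 3)) = Real.exp (-(2 * Real.log N ^ 4)) := by
    rw [Real.rpow_def_of_pos hNpos]; congr 1; ring
  have e2 : (N:ℝ) ^ 7 = Real.exp (7 * Real.log N) := by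
    rw [mul_comm, Real.exp_mul, Real.exp_log hNpos]; norm_cast
  have e3 : (1 + (N:ℝ)) * (8 * N ^ 2) ≤ N ^ 7 := by
    have a1 : 1 + (N:ℝ) ≤ N ^ 2 := by nlinarith
    have a2 : (8:ℝ) ≤ N ^ 3 := by
      calc (8:ℝ) = 2 ^ 3 := by norm_num
        _ ≤ _ := by gcongr
    calc _ ≤ (N:ℝ) ^ 2 * (N ^ 3 * N ^ 2) := by gcongr
      _ = _ := by ring
  have e4 : 7 * Real.log N ≤ 56 * Real.log N ^ 4 := by
    have a2 : (1 / 2 : ℝ) ^ 3 ≤ Real.log N ^ 3 := by gcongr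
    nlinarith
  calc E + N * E = N ^ m * (((1 + (N:ℝ)) * (8 * N ^ 2)) * Real.exp (-(L / 4096))) := by
        rw [hE]; ring
    _ ≤ N ^ m * (N ^ 7 * Real.exp (-(L / 4096))) := by gcongr
    _ ≤ _ := by
        rw [e1, e2, ← Real.exp_add]
        gcongr
        linarith

lemma measure_lower {N m : ℕ} (hN : 0 < N) (P : (Fin m → Fin N) → Prop) [DecidablePred P] (p : ℝ)
    (h : ((Finset.univ.filter fun ω => ¬ P ω).card : ℝ) ≤ N ^ m * p) :
    (((N : ℝ≥0∞) ^ m)⁻¹ • Measure.count : Measure (Fin m → Fin N)) {ω | P ω}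
      ≥ ENNReal.ofReal (1 - p) := by
  have hNpos : (0:ℝ) < N := by exact_mod_cast hN
  have e : {ω | P ω} = ((Finset.univ.filter P : Finset (Fin m → Fin N)) : Set (Fin m → Fin N)) := by
    ext; simp
  rw [e, Measure.smul_apply, Measure.count_apply_finset, smul_eq_mul, ge_iff_le]
  have hc := Finset.card_filter_add_card_filter_not (s := (Finset.univ : Finset (Fin m → Fin N))) P
  have hc' : ((Finset.univ.filter P).card : ℝ) + (Finset.univ.filter fun ω => ¬ P ω).card
     = N ^ m := by
    have : (Finset.univ : Finset (Fin m → Fin N)).card = N ^ m := by simp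
    rw [this] at hc
    exact_mod_cast hc
  have e2 : ((N : ℝ≥0∞) ^ m)⁻¹ * ((Finset.univ.filter P).card : ℝ≥0∞)
      = ENNReal.ofReal (((N:ℝ) ^ m)⁻¹ * ((Finset.univ.filter P).card : ℝ)) := by
    rw [ENNReal.ofReal_mul (by positivity), ENNReal.ofReal_inv_of_pos (by positivity),
      ENNReal.ofReal_pow hNpos.le]
    simp
  rw [e2]
  apply ENNReal.ofReal_le_ofReal
  rw [inv_mul_eq_div, le_div_iff₀ (by positivity)]
  linarith

end Golf

open Golf

theorem statement0 :
    ∃ C > (0 : ℝ), ∃ γ > (1 : ℝ),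
      ∀ (N m s : ℕ) (Φ Ψ : Matrix (Fin N) (Fin N) ℂ),
        Φᴴ * Φ = 1 → Ψᴴ * Ψ = 1 →
        ∀ μ : ℝ, μ = ⨆ i : Fin N, ⨆ j : Fin N, ‖∑ k, (starRingEnd ℂ) (Φ k i) * Ψ k j‖ →
        ∀ α : Fin N → ℂ, {i | α i ≠ 0}.ncard ≤ s →
        (m : ℝ) ≥ C * N * μ ^ 2 * s * Real.log N ^ 4 →
        (((N : ℝ≥0∞) ^ m)⁻¹ • Measure.count : Measure (Fin m → Fin N))
            {ω | ∀ β : Fin N → ℂ,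
              (∀ i, (Φᴴ * Ψ).mulVec β (ω i) = (Φᴴ * Ψ).mulVec α (ω i)) →
              β ≠ α → ∑ i, ‖α i‖ < ∑ i, ‖β i‖}
          ≥ ENNReal.ofReal (1 - (N : ℝ) ^ (-(γ * Real.log N ^ 3))) := by
  classical
  refine ⟨4096 * 58, by norm_num, 2, by norm_num, ?_⟩
  intro N m s Φ Ψ hΦ hΨ μ hμ α hs hm
  by_cases hN : N < 2
  · have : N = 0 ∨ N = 1 := by omega
    rcases this with h | h <;> subst h <;> simp
  have hN : 2 ≤ N := by omega
  have hN0 : 0 < N := by omega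
  have hNpos : (0:ℝ) < N := by exact_mod_cast hN0
  apply measure_lower hN0
  set U := Φᴴ * Ψ with hU
  have hUU : Uᴴ * U = 1 := by
    rw [hU, conjTranspose_mul, conjTranspose_conjTranspose, Matrix.mul_assoc,
      ← Matrix.mul_assoc Φ, mul_eq_one_comm.1 hΦ, Matrix.one_mul, hΨ]
  have hUμ : ∀ i j, ‖U i j‖ ≤ μ := by
    intro i j
    have e : U i j = ∑ k, (starRingEnd ℂ) (Φ k i) * Ψ k j := by
      simp [hU, Matrix.mul_apply]
    rw [e, hμ]
    refine le_trans ?_ (le_ciSup (Set.finite_range _).bddAbove i)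
    exact le_ciSup (f := fun j => ‖∑ k, (starRingEnd ℂ) (Φ k i) * Ψ k j‖)
      (Set.finite_range _).bddAbove j
  set T : Finset (Fin N) := Finset.univ.filter fun j => α j ≠ 0 with hTdef
  have hTc : T.card ≤ s := by
    have : {i | α i ≠ 0} = (T : Set (Fin N)) := by ext; simp [hTdef]
    rwa [this, Set.ncard_coe_finset] at hs
  have hα : ∀ j, j ∈ T ↔ α j ≠ 0 := by simp [hTdef]
  rcases Nat.eq_zero_or_pos T.card with hT0 | hT
  · have hα0 : α = 0 := by
      funext j
      by_contra hc
      have := (hα j).2 hc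
      rw [Finset.card_eq_zero.1 hT0] at this
      simp at this
    rw [Finset.filter_false_of_mem]
    · simp; positivity
    · intro ω _
      rw [not_not]
      intro β _ hβ
      rw [hα0] at hβ ⊢
      simp only [Pi.zero_apply, norm_zero, Finset.sum_const_zero]
      obtain ⟨j, hj⟩ := Function.ne_iff.1 hβ
      exact Finset.sum_pos' (fun _ _ => norm_nonneg _) ⟨j, Finset.mem_univ _, by simpa using hj⟩
  set B : Fin N → Fin N → ℂ := fun l j => (√(N:ℝ) : ℂ) * U l j with hBdef
  have hsq : (√(N:ℝ) : ℂ) * (√(N:ℝ) : ℂ) = N := by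
    rw [← Complex.ofReal_mul, Real.mul_self_sqrt hNpos.le]; simp
  have hB : ∀ i j, ∑ l, (starRingEnd ℂ) (B l i) * B l j = if i = j then (N : ℂ) else 0 := by
    intro i j
    have h1 := congrFun (congrFun hUU i) j
    rw [Matrix.mul_apply, Matrix.one_apply] at h1
    simp only [conjTranspose_apply] at h1
    calc _ = ∑ l, (N:ℂ) * (star (U l i) * U l j) := by
          refine Finset.sum_congr rfl fun l _ => ?_
          rw [← hsq, ← starRingEnd_apply]
          simp only [hBdef, map_mul, Complex.conj_ofReal]
          ring
      _ = _ := by rw [← Finset.mul_sum, h1]; split_ifs <;> simp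
  have hK : ∀ l j, ‖B l j‖ ^ 2 ≤ N * μ ^ 2 := by
    intro l j
    simp only [hBdef, norm_mul, mul_pow]
    rw [Complex.norm_real, Real.norm_eq_abs, sq_abs, Real.sq_sqrt hNpos.le]
    gcongr
    exact hUμ l j
  have hK0 : 0 < N * μ ^ 2 := by
    obtain ⟨j⟩ : Nonempty (Fin N) := ⟨⟨0, hN0⟩⟩
    by_contra hc
    have hz : ∀ l j, B l j = 0 := by
      intro l j
      have := hK l j
      have h2 : ‖B l j‖ ^ 2 = 0 := le_antisymm (by linarith) (by positivity)
      simpa using h2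
    have := hB j j
    simp only [hz, mul_zero, Finset.sum_const_zero, if_true] at this
    have h3 : N = 0 := by exact_mod_cast this.symm
    omega
  have hm' : 4096 * 58 * (N * μ ^ 2) * T.card * Real.log N ^ 4 ≤ m := by
    have h1 : (T.card : ℝ) ≤ s := by exact_mod_cast hTc
    calc _ ≤ 4096 * 58 * (N * μ ^ 2) * s * Real.log N ^ 4 := by gcongr
      _ = 4096 * 58 * N * μ ^ 2 * s * Real.log N ^ 4 := by ring
      _ ≤ m := hm
  have key := main_count hN B T (N * μ ^ 2) hK0 hT hK hB α hα m hm'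
  refine le_trans ?_ key
  have hsub : (Finset.univ.filter fun ω : Fin m → Fin N => ¬ ∀ β : Fin N → ℂ,
      (∀ i, U.mulVec β (ω i) = U.mulVec α (ω i)) → β ≠ α → ∑ i, ‖α i‖ < ∑ i, ‖β i‖) ⊆
     (Finset.univ.filter fun ω : Fin m → Fin N => ¬ ∀ β : Fin N → ℂ,
      (∀ i, ∑ j, B (ω i) j * (β j - α j) = 0) → β ≠ α → ∑ i, ‖α i‖ < ∑ i, ‖β i‖) := by
    intro ω hω
    simp only [Finset.mem_filter, Finset.mem_univ, true_and] at hω ⊢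
    refine fun hc => hω fun β h1 h2 => hc β (fun i => ?_) h2
    have h3 := h1 i
    simp only [Matrix.mulVec, dotProduct] at h3
    calc _ = (√(N:ℝ) : ℂ) * (∑ j, U (ω i) j * β j - ∑ j, U (ω i) j * α j) := by
          rw [← Finset.sum_sub_distrib, Finset.mul_sum]
          refine Finset.sum_congr rfl fun j _ => ?_
          simp only [hBdef]; ring
      _ = 0 := by rw [h3]; simp
  exact_mod_cast Finset.card_le_card hsub
end

section
/- Let Φ = (φ_1, ..., φ_N) and Ψ = (ψ_1, ..., ψ_N) be orthonormal bases of C^N, let c = (c_1, ..., c_N) be a random Rademacher sequence (i.i.d. entries equal to +1 or −1 each with probability 1/2), let C be the N×N diagonal matrix with diagonal c, and let μ = max_{1≤i,j≤N} |⟨φ_i, C ψ_j⟩| be the (random) mutual coherence of the modulated system. Then for every u > 0, the probability that μ > u is at most 2 N² exp(−u² / (2 β²(Φ, Ψ))), where β(Φ, Ψ) is the modulus-coherence of the pair (Φ, Ψ). -/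
open MeasureTheory Matrix
open scoped ENNReal

lemma cosh_pair (x a : ℂ) : Real.cosh ‖x + a‖ + Real.cosh ‖x - a‖
    ≤ 2 * (Real.cosh ‖x‖ * Real.cosh ‖a‖) := by
  have e : 2 * (Real.cosh ‖x‖ * Real.cosh ‖a‖)
      = Real.cosh (‖x‖ + ‖a‖) + Real.cosh (‖x‖ - ‖a‖) := by
    rw [Real.cosh_add, Real.cosh_sub]; ring
  rw [e]
  refine hasSum_le ?_ ((Real.hasSum_cosh ‖x + a‖).add (Real.hasSum_cosh ‖x - a‖))
    ((Real.hasSum_cosh (‖x‖ + ‖a‖)).add (Real.hasSum_cosh (‖x‖ - ‖a‖)))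
  intro n
  rw [← add_div, ← add_div]
  refine div_le_div_of_nonneg_right ?_ (by positivity)
  simp only [pow_mul]
  have hpar := parallelogram_law_with_norm ℝ x a
  have hP : ‖x + a‖ ^ 2 ≤ (‖x‖ + ‖a‖) ^ 2 := by gcongr; exact norm_add_le x a
  have hM : ‖x - a‖ ^ 2 ≤ (‖x‖ + ‖a‖) ^ 2 := by gcongr; exact norm_sub_le x a
  have hs : ‖x + a‖ ^ 2 + ‖x - a‖ ^ 2 = (‖x‖ + ‖a‖) ^ 2 + (‖x‖ - ‖a‖) ^ 2 := by
    linarith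
  have hL : 0 ≤ (‖x‖ - ‖a‖) ^ 2 := sq_nonneg _
  have hR : 0 ≤ (‖x‖ + ‖a‖) ^ 2 := sq_nonneg _
  generalize ‖x + a‖ ^ 2 = P at *
  generalize ‖x - a‖ ^ 2 = M at *
  generalize (‖x‖ + ‖a‖) ^ 2 = R at *
  generalize (‖x‖ - ‖a‖) ^ 2 = L at *
  rcases eq_or_lt_of_le (show L ≤ R by linarith) with h | h
  · have h1 : P = R := by linarith
    have h2 : M = L := by linarith
    rw [h1, h2]
  · have hd : 0 < R - L := by linarith
    have cvx : ∀ x : ℝ, 0 ≤ x → ∀ y : ℝ, 0 ≤ y → ∀ a b : ℝ, 0 ≤ a → 0 ≤ b → a + b = 1 →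
        (a * x + b * y) ^ n ≤ a * x ^ n + b * y ^ n := by
      intro x hx y hy a b ha hb hab
      exact (convexOn_pow (𝕜 := ℝ) n).2 hx hy ha hb hab
    have h1 := cvx R hR L hL
      ((P - L) / (R - L)) ((R - P) / (R - L))
      (div_nonneg (by linarith) hd.le) (div_nonneg (by linarith) hd.le) (by field_simp; ring)
    have h2 := cvx R hR L hL
      ((R - P) / (R - L)) ((P - L) / (R - L))
      (div_nonneg (by linarith) hd.le) (div_nonneg (by linarith) hd.le) (by field_simp; ring)
    have e1 : (P - L) / (R - L) * R + (R - P) / (R - L) * L = P := by field_simp; ring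
    have e2 : (R - P) / (R - L) * R + (P - L) / (R - L) * L = M := by
      have : M = R + L - P := by linarith
      rw [this]; field_simp; ring
    rw [e1] at h1
    rw [e2] at h2
    have e3 : (P - L) / (R - L) * R ^ n + (R - P) / (R - L) * L ^ n
      + ((R - P) / (R - L) * R ^ n + (P - L) / (R - L) * L ^ n) = R ^ n + L ^ n := by
      field_simp; ring
    linarith

lemma sum_cosh (n : ℕ) : ∀ (a : Fin n → ℂ) (x : ℂ),
    ∑ b : Fin n → Bool, Real.cosh ‖x + ∑ k, (if b k then (1 : ℂ) else -1) * a k‖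
      ≤ 2 ^ n * (Real.cosh ‖x‖ * Real.exp ((∑ k, ‖a k‖ ^ 2) / 2)) := by
  induction n with
  | zero => intro a x; simp
  | succ n ih =>
    intro a x
    rw [← (Fin.consEquiv (fun _ : Fin (n + 1) => Bool)).sum_comp, Fintype.sum_prod_type]
    simp only [Fintype.sum_bool, Fin.consEquiv_apply, Fin.sum_univ_succ, Fin.cons_zero,
      Fin.cons_succ, ← add_assoc]
    have h1 := ih (fun k => a k.succ) (x + a 0)
    have h2 := ih (fun k => a k.succ) (x - a 0)
    have h3 := cosh_pair x (a 0)
    have h4 := Real.cosh_le_exp_half_sq ‖a 0‖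
    have e1 : (if true then (1 : ℂ) else -1) * a 0 = a 0 := by simp
    have e2 : x + (if false then (1 : ℂ) else -1) * a 0 = x - a 0 := by simp [sub_eq_add_neg]
    simp only [if_true, one_mul, Bool.false_eq_true, if_false, neg_mul, ← sub_eq_add_neg] at *
    rw [add_div, Real.exp_add]
    set E := Real.exp ((∑ k : Fin n, ‖a k.succ‖ ^ 2) / 2)
    have hE : 0 < E := Real.exp_pos _
    calc _ ≤ _ := add_le_add h1 h2
      _ = 2 ^ n * E * (Real.cosh ‖x + a 0‖ + Real.cosh ‖x - a 0‖) := by ring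
      _ ≤ 2 ^ n * E * (2 * (Real.cosh ‖x‖ * Real.exp (‖a 0‖ ^ 2 / 2))) := by
        gcongr
        refine h3.trans ?_
        have := Real.cosh_pos ‖x‖
        gcongr
      _ = _ := by ring

lemma markov_cosh {α : Type*} [Fintype α] (T : α → ℝ) (l u : ℝ) (hl : 0 < l)
    [Fintype {b | u < T b}] :
    (Fintype.card {b | u < T b} : ℝ) * (Real.exp (l * u) / 2) ≤ ∑ b, Real.cosh (l * T b) := by
  calc (Fintype.card {b | u < T b} : ℝ) * (Real.exp (l * u) / 2)
      = ∑ b ∈ {b | u < T b}.toFinset, Real.exp (l * u) / 2 := by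
        rw [Finset.sum_const, Set.toFinset_card, nsmul_eq_mul]
    _ ≤ ∑ b ∈ {b | u < T b}.toFinset, Real.cosh (l * T b) := by
      refine Finset.sum_le_sum fun b hb => ?_
      have hb' : u < T b := by simpa using hb
      have h1 : Real.exp (l * u) ≤ Real.exp (l * T b) :=
        Real.exp_le_exp.2 (mul_le_mul_of_nonneg_left hb'.le hl.le)
      rw [Real.cosh_eq]
      have := Real.exp_pos (-(l * T b))
      linarith
    _ ≤ ∑ b, Real.cosh (l * T b) :=
      Finset.sum_le_sum_of_subset_of_nonneg (Finset.subset_univ _)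
        fun b _ _ => (Real.cosh_pos _).le

lemma tail (n : ℕ) (a : Fin n → ℂ) (β u : ℝ) (hβ : 0 < β) (hu : 0 < u)
    (h : ∑ k, ‖a k‖ ^ 2 ≤ β ^ 2) :
    (PMF.uniformOfFintype (Fin n → Bool)).toMeasure
        {b | u < ‖∑ k, (if b k then (1 : ℂ) else -1) * a k‖}
      ≤ ENNReal.ofReal (2 * Real.exp (-(u ^ 2) / (2 * β ^ 2))) := by
  classical
  rw [PMF.toMeasure_uniformOfFintype_apply _ (Set.toFinite _).measurableSet]
  set S := {b : Fin n → Bool | u < ‖∑ k, (if b k then (1 : ℂ) else -1) * a k‖} with hS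
  set l : ℝ := u / β ^ 2 with hl
  have hl0 : 0 < l := by positivity
  have key := sum_cosh n (fun k => (l : ℂ) * a k) 0
  have e (b : Fin n → Bool) : ‖(0 : ℂ) + ∑ k, (if b k then (1 : ℂ) else -1) * ((l : ℂ) * a k)‖
      = l * ‖∑ k, (if b k then (1 : ℂ) else -1) * a k‖ := by
    have : ∑ k, (if b k then (1 : ℂ) else -1) * ((l : ℂ) * a k)
      = l * ∑ k, (if b k then (1 : ℂ) else -1) * a k := by
      rw [Finset.mul_sum]; exact Finset.sum_congr rfl fun k _ => by ring
    rw [zero_add, this, norm_mul, Complex.norm_real, Real.norm_of_nonneg hl0.le]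
  simp only [e, norm_zero, Real.cosh_zero, one_mul, norm_mul, Complex.norm_real,
    Real.norm_of_nonneg hl0.le, mul_pow, ← Finset.mul_sum] at key
  have hcard : (Fintype.card S : ℝ) * (Real.exp (l * u) / 2)
      ≤ 2 ^ n * Real.exp (l ^ 2 * β ^ 2 / 2) := by
    refine (markov_cosh _ l u hl0).trans (key.trans ?_)
    gcongr
  have hfin : (Fintype.card S : ℝ) / 2 ^ n ≤ 2 * Real.exp (-(u ^ 2) / (2 * β ^ 2)) := by
    have e1 : -(u ^ 2) / (2 * β ^ 2) = l ^ 2 * β ^ 2 / 2 - l * u := by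
      rw [hl]; field_simp; ring
    rw [e1, Real.exp_sub, div_le_iff₀ (by positivity)]
    have := Real.exp_pos (l * u)
    rw [← le_div_iff₀ (by positivity)] at hcard
    refine hcard.trans (le_of_eq ?_)
    field_simp
  refine le_trans (le_of_eq ?_) (ENNReal.ofReal_le_ofReal hfin)
  rw [ENNReal.ofReal_div_of_pos (by positivity)]
  congr 1
  · rw [ENNReal.ofReal_natCast]
  · simp [ENNReal.ofReal_pow]

/-- union bound in the proof of Lemma 1.
Let `Φ, Ψ` be orthonormal bases of `ℂ^N`, let `c` be a random Rademacher sequence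
(modeled by the uniform probability measure on `Fin N → Bool`, `c b k = ±1`) and let
`μ(b) = max_{i,j} |⟨φ_i, C ψ_j⟩|` be the random mutual coherence of the modulated system.
Then for every `u > 0`, `ℙ(μ > u) ≤ 2 N² exp(-u² / (2 β²(Φ, Ψ)))`, where
`β(Φ, Ψ) = max_{i,j} sqrt(∑ₖ |φ_{ki}* ψ_{kj}|²)` is the modulus-coherence. -/
theorem statement3 (N : ℕ) (Φ Ψ : Matrix (Fin N) (Fin N) ℂ)
    (hΦ : Φᴴ * Φ = 1) (hΨ : Ψᴴ * Ψ = 1)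
    (β : ℝ)
    (hβ : β = ⨆ i : Fin N, ⨆ j : Fin N,
      Real.sqrt (∑ k, ‖(starRingEnd ℂ) (Φ k i) * Ψ k j‖ ^ 2))
    (u : ℝ) (hu : 0 < u) :
    (PMF.uniformOfFintype (Fin N → Bool)).toMeasure
        {b | (⨆ i : Fin N, ⨆ j : Fin N,
          ‖∑ k, (if b k then (1 : ℂ) else -1) * ((starRingEnd ℂ) (Φ k i) * Ψ k j)‖) > u}
      ≤ ENNReal.ofReal (2 * N ^ 2 * Real.exp (-(u ^ 2) / (2 * β ^ 2))) := by
  rcases Nat.eq_zero_or_pos N with rfl | hN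
  · simp [not_lt.mpr hu.le]
  have : Nonempty (Fin N) := ⟨⟨0, hN⟩⟩
  have hle (i j : Fin N) : Real.sqrt (∑ k, ‖(starRingEnd ℂ) (Φ k i) * Ψ k j‖ ^ 2) ≤ β := by
    rw [hβ]
    refine le_trans ?_ (le_ciSup (Set.finite_range _).bddAbove i)
    exact le_ciSup (f := fun j => Real.sqrt (∑ k, ‖(starRingEnd ℂ) (Φ k i) * Ψ k j‖ ^ 2))
      (Set.finite_range _).bddAbove j
  have hβ0 : 0 ≤ β := (Real.sqrt_nonneg _).trans (hle ⟨0, hN⟩ ⟨0, hN⟩)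
  rcases hβ0.eq_or_lt with h0 | hpos
  · refine prob_le_one.trans ?_
    rw [← h0]
    have : (1 : ℝ) ≤ N := by exact_mod_cast hN
    simp only [ne_eq, OfNat.ofNat_ne_zero, not_false_eq_true, zero_pow, mul_zero, div_zero,
      Real.exp_zero, mul_one, ENNReal.one_le_ofReal]
    nlinarith
  · have hsub : {b : Fin N → Bool | (⨆ i : Fin N, ⨆ j : Fin N,
          ‖∑ k, (if b k then (1 : ℂ) else -1) * ((starRingEnd ℂ) (Φ k i) * Ψ k j)‖) > u}
        ⊆ ⋃ p : Fin N × Fin N, {b | u <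
          ‖∑ k, (if b k then (1 : ℂ) else -1) * ((starRingEnd ℂ) (Φ k p.1) * Ψ k p.2)‖} := by
      intro b hb
      obtain ⟨i, hi⟩ := exists_lt_of_lt_ciSup (show u < _ from hb)
      obtain ⟨j, hj⟩ := exists_lt_of_lt_ciSup hi
      exact Set.mem_iUnion.2 ⟨(i, j), hj⟩
    refine (measure_mono hsub).trans ((measure_iUnion_fintype_le _ _).trans ?_)
    have ht : ∀ p : Fin N × Fin N, (PMF.uniformOfFintype (Fin N → Bool)).toMeasure {b | u <
          ‖∑ k, (if b k then (1 : ℂ) else -1) * ((starRingEnd ℂ) (Φ k p.1) * Ψ k p.2)‖}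
          ≤ ENNReal.ofReal (2 * Real.exp (-(u ^ 2) / (2 * β ^ 2))) := fun p =>
      tail N (fun k => (starRingEnd ℂ) (Φ k p.1) * Ψ k p.2) β u hpos hu
        (Real.sqrt_le_iff.1 (hle p.1 p.2)).2
    refine (Finset.sum_le_sum fun p _ => ht p).trans (le_of_eq ?_)
    rw [Finset.sum_const, nsmul_eq_mul, show (2 * (N : ℝ) ^ 2 * Real.exp (-(u ^ 2) / (2 * β ^ 2)))
      = (N * N : ℕ) * (2 * Real.exp (-(u ^ 2) / (2 * β ^ 2))) by push_cast; ring,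
      ENNReal.ofReal_mul (p := ((N * N : ℕ) : ℝ)) (by positivity), ENNReal.ofReal_natCast]
    simp
end

section
/- Let ε ∈ (0, 1), let Φ = (φ_1, ..., φ_N) and Ψ = (ψ_1, ..., ψ_N) be orthonormal bases of C^N, let c ∈ C^N be a random Rademacher sequence (i.i.d. entries equal to +1 or −1 each with probability 1/2), and let C be the N×N diagonal matrix with diagonal c. Then with probability at least 1 − ε, the mutual coherence μ = max_{1≤i,j≤N} |⟨φ_i, C ψ_j⟩| satisfies μ ≤ β(Φ, Ψ) sqrt(2 log(2N²/ε)). -/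
open MeasureTheory Matrix
open scoped ENNReal

lemma aux_pow (n : ℕ) (X W h : ℝ) (hW : 0 ≤ W) (hX : W ≤ X) (hh : 0 ≤ h) :
    (W + h) ^ n - W ^ n ≤ (X + h) ^ n - X ^ n := by
  induction n with
  | zero => simp
  | succ n ih =>
    have e : ∀ T : ℝ, (T + h) ^ (n+1) - T ^ (n+1) = T * ((T + h)^n - T^n) + h * (T + h)^n := by
      intro T; ring
    rw [e, e]
    have h1 : 0 ≤ (W + h)^n - W^n := sub_nonneg.2 (pow_le_pow_left₀ hW (by linarith) n)
    have h2 : (W + h)^n ≤ (X + h)^n := pow_le_pow_left₀ (by linarith) (by linarith) n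
    have h3 := mul_le_mul hX ih h1 (by linarith)
    have h4 := mul_le_mul_of_nonneg_left h2 hh
    linarith

lemma aux_cosh (x d : ℂ) :
    Real.cosh ‖x + d‖ + Real.cosh ‖x - d‖ ≤ 2 * (Real.cosh ‖x‖ * Real.cosh ‖d‖) := by
  have e : 2 * (Real.cosh ‖x‖ * Real.cosh ‖d‖)
      = Real.cosh (‖x‖ + ‖d‖) + Real.cosh (‖x‖ - ‖d‖) := by
    rw [Real.cosh_add, Real.cosh_sub]; ring
  rw [e]
  refine hasSum_le ?_ ((Real.hasSum_cosh _).add (Real.hasSum_cosh _))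
    ((Real.hasSum_cosh _).add (Real.hasSum_cosh _))
  intro n
  rw [← add_div, ← add_div]
  gcongr ?_ / _
  simp only [pow_mul]
  have hp := parallelogram_law_with_norm ℝ x d
  have h1 : ‖x + d‖ ^ 2 ≤ (‖x‖ + ‖d‖) ^ 2 := by gcongr; exact norm_add_le _ _
  have h2 : ‖x - d‖ ^ 2 ≤ (‖x‖ + ‖d‖) ^ 2 := by gcongr; exact norm_sub_le _ _
  have h := aux_pow n (‖x + d‖ ^ 2) ((‖x‖ - ‖d‖) ^ 2) ((‖x‖ + ‖d‖) ^ 2 - ‖x + d‖ ^ 2)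
    (sq_nonneg _) (by nlinarith) (by linarith)
  have e1 : (‖x‖ - ‖d‖) ^ 2 + ((‖x‖ + ‖d‖) ^ 2 - ‖x + d‖ ^ 2) = ‖x - d‖ ^ 2 := by nlinarith
  rw [e1, add_sub_cancel] at h
  linarith

lemma aux_sum (N : ℕ) (a : Fin N → ℂ) (x : ℂ) :
    ∑ b : Fin N → Bool, Real.cosh ‖x + ∑ k, (if b k then (1 : ℂ) else -1) * a k‖
      ≤ 2 ^ N * (Real.cosh ‖x‖ * ∏ k, Real.cosh ‖a k‖) := by
  induction N generalizing x with
  | zero => simp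
  | succ N ih =>
    rw [← (Fin.consEquiv (fun _ : Fin (N+1) => Bool)).sum_comp, Fintype.sum_prod_type]
    simp only [Fin.consEquiv, Equiv.coe_fn_mk, Fin.sum_univ_succ, Fin.cons_zero, Fin.cons_succ,
      Fintype.sum_bool, if_true, Fin.prod_univ_succ, ← add_assoc]
    have h1 := ih (fun k => a k.succ) (x + a 0)
    have h2 := ih (fun k => a k.succ) (x - a 0)
    have h3 := aux_cosh x (a 0)
    have hP : 0 ≤ 2 ^ N * ∏ k : Fin N, Real.cosh ‖a k.succ‖ :=
      mul_nonneg (by positivity) (Finset.prod_nonneg fun k _ => (Real.cosh_pos _).le)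
    have h4 := mul_le_mul_of_nonneg_left h3 hP
    simp only [one_mul, Bool.false_eq_true, if_false, neg_one_mul, ← sub_eq_add_neg] at *
    rw [pow_succ]
    linarith

lemma aux_tail (N : ℕ) (a : Fin N → ℂ) (β L : ℝ) (hβ : 0 ≤ β) (hL : 0 ≤ L)
    (ha : ∑ k, ‖a k‖ ^ 2 ≤ β ^ 2) :
    ((Finset.univ.filter fun b : Fin N → Bool =>
      β * Real.sqrt (2 * L) < ‖∑ k, (if b k then (1 : ℂ) else -1) * a k‖).card : ℝ)
      ≤ 2 ^ N * (2 * Real.exp (-L)) := by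
  rcases hβ.eq_or_lt with rfl | hβ
  · have h0 : ∀ k, a k = 0 := by
      intro k
      have := Finset.single_le_sum (f := fun k => ‖a k‖ ^ 2) (fun i _ => sq_nonneg _)
        (Finset.mem_univ k)
      have h2 : ‖a k‖ ^ 2 ≤ 0 := by linarith
      simpa using le_antisymm h2 (sq_nonneg _)
    simp [h0]
    positivity
  set l := Real.sqrt (2 * L) / β with hl
  have hl0 : 0 ≤ l := by positivity
  have hl2 : l ^ 2 * β ^ 2 = 2 * L := by
    rw [hl, div_pow, Real.sq_sqrt (by positivity)]; field_simp
  have h := aux_sum N (fun k => (l : ℂ) * a k) 0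
  have hprod : ∏ k, Real.cosh ‖(l : ℂ) * a k‖ ≤ Real.exp L := by
    calc _ ≤ ∏ k, Real.exp (‖(l : ℂ) * a k‖ ^ 2 / 2) :=
          Finset.prod_le_prod (fun k _ => (Real.cosh_pos _).le)
            fun k _ => Real.cosh_le_exp_half_sq _
      _ = Real.exp (l ^ 2 * (∑ k, ‖a k‖ ^ 2) / 2) := by
          rw [← Real.exp_sum, Finset.mul_sum, Finset.sum_div]
          simp [mul_pow]
      _ ≤ _ := by
          apply Real.exp_le_exp.2
          have := mul_le_mul_of_nonneg_left ha (sq_nonneg l)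
          linarith
  set F := Finset.univ.filter fun b : Fin N → Bool =>
      β * Real.sqrt (2 * L) < ‖∑ k, (if b k then (1 : ℂ) else -1) * a k‖ with hF
  have hlow : (F.card : ℝ) * (Real.exp (2 * L) / 2) ≤
      ∑ b : Fin N → Bool,
        Real.cosh ‖0 + ∑ k, (if b k then (1 : ℂ) else -1) * ((l : ℂ) * a k)‖ := by
    rw [← nsmul_eq_mul]
    refine (Finset.card_nsmul_le_sum F _ _ ?_).trans
      (Finset.sum_le_sum_of_subset_of_nonneg (Finset.subset_univ F)
        fun b _ _ => (Real.cosh_pos _).le)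
    intro b hb
    rw [hF, Finset.mem_filter] at hb
    have e : (0 : ℂ) + ∑ k, (if b k then (1 : ℂ) else -1) * ((l : ℂ) * a k)
        = l * ∑ k, (if b k then (1 : ℂ) else -1) * a k := by
      rw [zero_add, Finset.mul_sum]
      exact Finset.sum_congr rfl fun k _ => by ring
    rw [e, norm_mul, Complex.norm_real, Real.norm_of_nonneg hl0]
    have h5 : 2 * L ≤ l * ‖∑ k, (if b k then (1 : ℂ) else -1) * a k‖ := by
      have h6 := mul_le_mul_of_nonneg_left hb.2.le hl0
      have h7 : l * (β * Real.sqrt (2 * L)) = 2 * L := by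
        rw [hl]; field_simp; exact Real.sq_sqrt (by positivity)
      linarith
    rw [Real.cosh_eq]
    have := Real.exp_le_exp.2 h5
    have h8 := Real.exp_pos (-(l * ‖∑ k, (if b k then (1 : ℂ) else -1) * a k‖))
    linarith
  have h9 : (F.card : ℝ) * (Real.exp (2 * L) / 2) ≤ 2 ^ N * Real.exp L := by
    refine (hlow.trans h).trans ?_
    simp only [norm_zero, Real.cosh_zero, one_mul]
    gcongr
  have h10 : Real.exp (2 * L) = Real.exp L * Real.exp L := by rw [← Real.exp_add]; ring_nf
  have h11 : Real.exp (-L) * Real.exp L = 1 := by rw [← Real.exp_add]; simp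
  have h12 := mul_le_mul_of_nonneg_right h9 (by positivity : 0 ≤ 2 * (Real.exp (-L) * Real.exp (-L)))
  calc (F.card : ℝ) = F.card * (Real.exp (-L) * Real.exp L) * (Real.exp (-L) * Real.exp L) := by
        rw [h11]; ring
    _ = F.card * (Real.exp (2 * L) / 2) * (2 * (Real.exp (-L) * Real.exp (-L))) := by
        rw [h10]; ring
    _ ≤ _ := h12
    _ = 2 ^ N * (2 * Real.exp (-L)) * (Real.exp (-L) * Real.exp L) := by ring
    _ = _ := by rw [h11]; ring

/-- Lemma 1 of the paper, Rademacher case.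
Let `ε ∈ (0,1)`, let `Φ, Ψ` be orthonormal bases of `ℂ^N` and let `c` be a random
Rademacher sequence (modeled by the uniform probability measure on `Fin N → Bool`,
`c b k = ±1`). Then with probability at least `1 - ε` the mutual coherence
`μ = max_{i,j} |⟨φ_i, C ψ_j⟩|` satisfies `μ ≤ β(Φ, Ψ) sqrt(2 log(2N²/ε))`. -/
theorem statement4 (ε : ℝ) (hε : ε ∈ Set.Ioo (0 : ℝ) 1)
    (N : ℕ) (Φ Ψ : Matrix (Fin N) (Fin N) ℂ)
    (hΦ : Φᴴ * Φ = 1) (hΨ : Ψᴴ * Ψ = 1)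
    (β : ℝ)
    (hβ : β = ⨆ i : Fin N, ⨆ j : Fin N,
      Real.sqrt (∑ k, ‖(starRingEnd ℂ) (Φ k i) * Ψ k j‖ ^ 2)) :
    (PMF.uniformOfFintype (Fin N → Bool)).toMeasure
        {b | (⨆ i : Fin N, ⨆ j : Fin N,
            ‖∑ k, (if b k then (1 : ℂ) else -1) * ((starRingEnd ℂ) (Φ k i) * Ψ k j)‖)
          ≤ β * Real.sqrt (2 * Real.log (2 * N ^ 2 / ε))}
      ≥ ENNReal.ofReal (1 - ε) := by
  classical
  obtain ⟨hε0, hε1⟩ := hε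
  set P := (PMF.uniformOfFintype (Fin N → Bool)).toMeasure with hP
  rcases Nat.eq_zero_or_pos N with rfl | hN
  · have : {b : Fin 0 → Bool | (⨆ i : Fin 0, ⨆ j : Fin 0,
            ‖∑ k, (if b k then (1 : ℂ) else -1) * ((starRingEnd ℂ) (Φ k i) * Ψ k j)‖)
          ≤ β * Real.sqrt (2 * Real.log (2 * (0 : ℕ) ^ 2 / ε))} = Set.univ := by
      ext b; simp [hβ]
    rw [this, measure_univ]
    simp [hε0.le]
  have : Nonempty (Fin N) := ⟨⟨0, hN⟩⟩
  have hN1 : (1 : ℝ) ≤ N := by exact_mod_cast hN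
  set L := Real.log (2 * N ^ 2 / ε) with hL
  have hL0 : 0 ≤ L := by
    apply Real.log_nonneg
    rw [le_div_iff₀ hε0]
    nlinarith
  have hle : ∀ i j, Real.sqrt (∑ k, ‖(starRingEnd ℂ) (Φ k i) * Ψ k j‖ ^ 2) ≤ β := by
    intro i j
    rw [hβ]
    exact (le_ciSup (f := fun j => Real.sqrt (∑ k, ‖(starRingEnd ℂ) (Φ k i) * Ψ k j‖ ^ 2))
      (Set.finite_range _).bddAbove j).trans
      (le_ciSup (f := fun i => ⨆ j, Real.sqrt (∑ k, ‖(starRingEnd ℂ) (Φ k i) * Ψ k j‖ ^ 2))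
      (Set.finite_range _).bddAbove i)
  have hβ0 : 0 ≤ β := (Real.sqrt_nonneg _).trans (hle ⟨0, hN⟩ ⟨0, hN⟩)
  set S := {b : Fin N → Bool | (⨆ i : Fin N, ⨆ j : Fin N,
            ‖∑ k, (if b k then (1 : ℂ) else -1) * ((starRingEnd ℂ) (Φ k i) * Ψ k j)‖)
          ≤ β * Real.sqrt (2 * L)} with hS
  let F : Fin N × Fin N → Finset (Fin N → Bool) := fun p =>
    Finset.univ.filter fun b : Fin N → Bool => β * Real.sqrt (2 * L) <
      ‖∑ k, (if b k then (1 : ℂ) else -1) * ((starRingEnd ℂ) (Φ k p.1) * Ψ k p.2)‖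
  let B := Finset.univ.biUnion F
  have hsub : Sᶜ ⊆ (B : Set (Fin N → Bool)) := by
    intro b hb
    by_contra hcon
    apply hb
    rw [hS, Set.mem_setOf_eq]
    refine ciSup_le fun i => ?_
    refine ciSup_le fun j => ?_
    by_contra hlt
    apply hcon
    simp only [B, F, Finset.coe_biUnion, Set.mem_iUnion]
    exact ⟨(i, j), by simp, by simpa using hlt⟩
  have hcard : (B.card : ℝ) ≤ ε * 2 ^ N := by
    calc (B.card : ℝ) ≤ ∑ p, ((F p).card : ℝ) := by exact_mod_cast Finset.card_biUnion_le
      _ ≤ ∑ p : Fin N × Fin N, 2 ^ N * (2 * Real.exp (-L)) := by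
          apply Finset.sum_le_sum
          intro p _
          apply aux_tail N _ β L hβ0 hL0
          exact (Real.sqrt_le_left hβ0).1 (hle p.1 p.2)
      _ = ε * 2 ^ N := by
          rw [Finset.sum_const, Finset.card_univ, Fintype.card_prod, Fintype.card_fin, hL,
            Real.exp_neg, Real.exp_log (by positivity), nsmul_eq_mul]
          push_cast
          field_simp
  have hPB : P (B : Set (Fin N → Bool)) ≤ ENNReal.ofReal ε := by
    rw [hP, PMF.toMeasure_uniformOfFintype_apply _ (Set.toFinite _).measurableSet]
    simp only [Finset.coe_sort_coe, Fintype.card_coe, Fintype.card_pi, Fintype.card_bool,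
      Finset.prod_const, Finset.card_univ, Fintype.card_fin]
    apply ENNReal.div_le_of_le_mul
    rw [← ENNReal.ofReal_natCast, ← ENNReal.ofReal_natCast, ← ENNReal.ofReal_mul hε0.le]
    apply ENNReal.ofReal_le_ofReal
    push_cast
    exact hcard
  have hc : P Sᶜ ≤ ENNReal.ofReal ε := (measure_mono hsub).trans hPB
  have hone : 1 ≤ P S + P Sᶜ := by
    rw [measure_add_measure_compl (Set.toFinite S).measurableSet, measure_univ]
  rw [ge_iff_le, ENNReal.ofReal_sub _ hε0.le, ENNReal.ofReal_one, tsub_le_iff_right]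
  exact hone.trans (by gcongr)
end

section
/- For any two orthonormal bases Φ and Ψ of C^N, the modulus-coherence satisfies β(Φ, Ψ) ≥ N^{-1/2}; that is, the value N^{-1/2} attained by universal sensing bases is optimal. -/
open Matrix

/-- For any two orthonormal bases `Φ, Ψ` of `ℂ^N`, the
modulus-coherence satisfies `β(Φ, Ψ) ≥ N^{-1/2}`. -/
theorem statement10 (N : ℕ) (Φ Ψ : Matrix (Fin N) (Fin N) ℂ)
    (hΦ : Φᴴ * Φ = 1) (hΨ : Ψᴴ * Ψ = 1) :
    (⨆ i : Fin N, ⨆ j : Fin N,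
        Real.sqrt (∑ k, ‖(starRingEnd ℂ) (Φ k i) * Ψ k j‖ ^ 2))
      ≥ (Real.sqrt N)⁻¹ := by
  rcases Nat.eq_zero_or_pos N with h0 | hN
  · subst h0
    simp
  set B := (⨆ i : Fin N, ⨆ j : Fin N,
        Real.sqrt (∑ k, ‖(starRingEnd ℂ) (Φ k i) * Ψ k j‖ ^ 2)) with hB
  let j : Fin N := ⟨0, hN⟩
  have hle : ∀ i, Real.sqrt (∑ k, ‖(starRingEnd ℂ) (Φ k i) * Ψ k j‖ ^ 2) ≤ B := fun i =>
    le_trans (le_ciSup (f := fun j : Fin N =>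
        Real.sqrt (∑ k, ‖(starRingEnd ℂ) (Φ k i) * Ψ k j‖ ^ 2)) (Set.finite_range _).bddAbove j)
      (le_ciSup (f := fun i : Fin N => ⨆ j : Fin N,
        Real.sqrt (∑ k, ‖(starRingEnd ℂ) (Φ k i) * Ψ k j‖ ^ 2)) (Set.finite_range _).bddAbove i)
  have hB0 : 0 ≤ B := le_trans (Real.sqrt_nonneg _) (hle j)
  have hsq : ∀ i, ∑ k, ‖(starRingEnd ℂ) (Φ k i) * Ψ k j‖ ^ 2 ≤ B ^ 2 := fun i =>
    (Real.sqrt_le_left hB0).1 (hle i)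
  have hΦ' : Φ * Φᴴ = 1 := mul_eq_one_comm.1 hΦ
  have hrow : ∀ k, ∑ i, ‖Φ k i‖ ^ 2 = 1 := by
    intro k
    have h := congrFun (congrFun hΦ' k) k
    simp only [Matrix.mul_apply, Matrix.conjTranspose_apply, Matrix.one_apply_eq,
      RCLike.star_def, Complex.mul_conj'] at h
    exact_mod_cast h
  have hcol : ∑ k, ‖Ψ k j‖ ^ 2 = 1 := by
    have h := congrFun (congrFun hΨ j) j
    simp only [Matrix.mul_apply, Matrix.conjTranspose_apply, Matrix.one_apply_eq,
      RCLike.star_def, Complex.conj_mul'] at h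
    exact_mod_cast h
  have htot : ∑ i, ∑ k, ‖(starRingEnd ℂ) (Φ k i) * Ψ k j‖ ^ 2 = 1 := by
    rw [Finset.sum_comm]
    simp only [norm_mul, RCLike.norm_conj, mul_pow, ← Finset.sum_mul, hrow, one_mul, hcol]
  have h1 : (1 : ℝ) ≤ N * B ^ 2 := by
    have := Finset.sum_le_sum (fun i (_ : i ∈ Finset.univ) => hsq i)
    rw [htot] at this
    simpa using this
  have hNpos : (0 : ℝ) < N := by exact_mod_cast hN
  rw [ge_iff_le, ← Real.sqrt_inv]
  apply Real.sqrt_le_iff.2 ⟨hB0, ?_⟩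
  rw [inv_le_iff_one_le_mul₀ hNpos]
  linarith
end

section
/- There exist universal constants C > 0 and γ > 1 such that the following holds. Let N ≤ N_w, let U ∈ C^{N_w × N} satisfy U* U = I_N, let C ∈ C^{N_w × N_w} be a diagonal matrix whose diagonal entries all have complex magnitude 1, let F = (f_1, ..., f_{N_w}) ∈ C^{N_w × N_w} be a unitary matrix, let Ψ = (ψ_1, ..., ψ_N) ∈ C^{N × N} be a unitary matrix, and set μ_w = max_{1 ≤ i ≤ N_w, 1 ≤ j ≤ N} |⟨f_i, C U ψ_j⟩|. Let α ∈ C^N be an s-sparse vector, let l_1, ..., l_m be indices chosen independently and uniformly at random from {1, ..., N_w}, and let y = (F* C U Ψ)_Ω α ∈ C^m, where (F* C U Ψ)_Ω is the m×N matrix whose rows are the rows of F* C U Ψ indexed by l_1, ..., l_m. If m ≥ C N_w μ_w² s log⁴(N), then with probability at least 1 − N^{−γ log³(N)} the vector α is the unique minimizer of the problem: minimize ‖β‖₁ over β ∈ C^N subject to y = (F* C U Ψ)_Ω β. -/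
open MeasureTheory Matrix
open scoped ENNReal

lemma natCast_mul_re' (n : ℕ) (x : ℂ) : ((n : ℂ) * x).re = n * x.re := by simp

lemma chernoff_count {ι : Type*} [Fintype ι] (b : ℕ) (f : ι → ℝ) (e t σ lam : ℝ)
    (hl : 0 < lam) (hb : ∀ i, |lam * f i| ≤ 1)
    (h1 : ∑ i, f i = Fintype.card ι * e) (h2 : ∑ i, f i ^ 2 ≤ Fintype.card ι * σ) :
    (Set.ncard {ω : Fin b → ι | b * (e + t) ≤ ∑ i, f (ω i)} : ℝ)
      ≤ (Fintype.card ι : ℝ) ^ b * Real.exp (b * (lam ^ 2 * σ - lam * t)) := by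
  classical
  set n : ℝ := (Fintype.card ι : ℝ) with hn
  have hn0 : 0 ≤ n := by positivity
  have key : ∑ i, Real.exp (lam * f i) ≤ n * Real.exp (lam * e + lam ^ 2 * σ) := by
    calc ∑ i, Real.exp (lam * f i) ≤ ∑ i, (1 + lam * f i + lam ^ 2 * f i ^ 2) := by
          apply Finset.sum_le_sum
          intro i _
          have := Real.abs_exp_sub_one_sub_id_le (hb i)
          have := (abs_le.1 this).2
          nlinarith
      _ = n + lam * (∑ i, f i) + lam ^ 2 * ∑ i, f i ^ 2 := by
          simp [Finset.sum_add_distrib, Finset.mul_sum, hn]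
      _ ≤ n + lam * (n * e) + lam ^ 2 * (n * σ) := by
          rw [h1]; gcongr
      _ = n * (lam * e + lam ^ 2 * σ + 1) := by ring
      _ ≤ _ := by gcongr; exact Real.add_one_le_exp _
  have hset : (Set.ncard {ω : Fin b → ι | b * (e + t) ≤ ∑ i, f (ω i)} : ℝ)
      = ∑ ω : Fin b → ι, if b * (e + t) ≤ ∑ i, f (ω i) then (1:ℝ) else 0 := by
    rw [Finset.sum_boole, Set.ncard_eq_toFinset_card']
    simp
  rw [hset]
  calc _ ≤ ∑ ω : Fin b → ι, Real.exp (-(lam * (b * (e + t)))) * ∏ i, Real.exp (lam * f (ω i)) := by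
        apply Finset.sum_le_sum
        intro ω _
        rw [← Real.exp_sum, ← Real.exp_add, ← Finset.mul_sum]
        split_ifs with h
        · apply Real.one_le_exp
          nlinarith
        · positivity
    _ = Real.exp (-(lam * (b * (e + t)))) * (∑ i, Real.exp (lam * f i)) ^ b := by
        rw [Fintype.sum_pow, Finset.mul_sum]
    _ ≤ Real.exp (-(lam * (b * (e + t)))) * (n * Real.exp (lam * e + lam ^ 2 * σ)) ^ b := by
        gcongr
    _ = _ := by
        rw [mul_pow, ← Real.exp_nat_mul, mul_left_comm, ← Real.exp_add]
        congr 2; ring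

/-- the certificate predicate -/
def CertOK {ι : Type*} {N : ℕ} (A : Matrix ι (Fin N) ℂ) (S : Finset (Fin N)) (L : ℕ) (B : ℝ)
    (z : Fin N → ℂ) (T : Set ι) : Prop :=
  ∃ v ∈ Submodule.span ℂ (A '' T), (∀ j ∈ S, ‖v j - z j‖ ≤ B / 4 ^ L) ∧ ∀ j ∉ S, ‖v j‖ ≤ B / 3

lemma CertOK.mono {ι : Type*} {N : ℕ} {A : Matrix ι (Fin N) ℂ} {S : Finset (Fin N)} {L : ℕ} {B : ℝ}
    {z : Fin N → ℂ} {T T' : Set ι} (h : CertOK A S L B z T) (hT : T ⊆ T') :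
    CertOK A S L B z T' := by
  obtain ⟨v, hv, h⟩ := h
  exact ⟨v, Submodule.span_mono (Set.image_mono hT) hv, h⟩

/-- one golfing step: the sampled estimate of z -/
noncomputable def est {ι : Type*} [Fintype ι] {N : ℕ} (A : Matrix ι (Fin N) ℂ) (z : Fin N → ℂ) (l : ι) :
    Fin N → ℂ := fun j => (Fintype.card ι : ℂ) * (∑ k, star (A l k) * z k) * A l j

lemma est_sum {ι : Type*} [Fintype ι] {N : ℕ} (A : Matrix ι (Fin N) ℂ) (hA : Aᴴ * A = 1)
    (z : Fin N → ℂ) (j : Fin N) : ∑ l, est A z l j = Fintype.card ι * z j := by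
  have h : ∀ k, ∑ l, star (A l k) * A l j = if k = j then 1 else 0 := by
    intro k
    have := congrFun (congrFun hA k) j
    simpa [Matrix.mul_apply, Matrix.one_apply] using this
  simp only [est, mul_assoc, ← Finset.mul_sum]
  congr 1
  calc ∑ l, (∑ k, star (A l k) * z k) * A l j = ∑ k, z k * ∑ l, star (A l k) * A l j := by
        simp only [Finset.sum_mul, Finset.mul_sum]
        rw [Finset.sum_comm]
        refine Finset.sum_congr rfl fun k _ => Finset.sum_congr rfl fun l _ => by ring
    _ = z j := by simp only [h]; simp

lemma inner_sq {ι : Type*} [Fintype ι] {N : ℕ} (A : Matrix ι (Fin N) ℂ) (hA : Aᴴ * A = 1)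
    (z : Fin N → ℂ) : ∑ l, ‖∑ k, star (A l k) * z k‖ ^ 2 = ∑ k, ‖z k‖ ^ 2 := by
  have h : ∀ j k, ∑ l, star (A l k) * A l j = if k = j then 1 else 0 := by
    intro j k
    have := congrFun (congrFun hA k) j
    simpa [Matrix.mul_apply, Matrix.one_apply] using this
  have : ((∑ l, ‖∑ k, star (A l k) * z k‖ ^ 2 : ℝ) : ℂ) = ((∑ k, ‖z k‖ ^ 2 : ℝ) : ℂ) := by
    push_cast
    simp only [← Complex.conj_mul']
    calc _ = ∑ l, ∑ j, ∑ k, star (z j) * z k * (star (A l k) * A l j) := by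
          refine Finset.sum_congr rfl fun l _ => ?_
          rw [map_sum, Finset.sum_mul_sum]
          refine Finset.sum_congr rfl fun j _ => Finset.sum_congr rfl fun k _ => ?_
          simp; ring
      _ = ∑ j, ∑ k, star (z j) * z k * ∑ l, star (A l k) * A l j := by
          rw [Finset.sum_comm]
          refine Finset.sum_congr rfl fun j _ => ?_
          rw [Finset.sum_comm]
          refine Finset.sum_congr rfl fun k _ => ?_
          rw [Finset.mul_sum]
      _ = _ := by simp only [h]; simp
  exact_mod_cast this

lemma est_bound {ι : Type*} [Fintype ι] {N : ℕ} (A : Matrix ι (Fin N) ℂ)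
    (μ : ℝ) (hμ : ∀ l j, ‖A l j‖ ≤ μ) (S : Finset (Fin N)) (s : ℝ) (hs : (S.card : ℝ) ≤ s)
    (z : Fin N → ℂ) (B : ℝ) (hB : 0 ≤ B) (hz : ∀ j, ‖z j‖ ≤ B) (hzS : ∀ j ∉ S, z j = 0) (l : ι) (j : Fin N) :
    ‖est A z l j‖ ≤ Fintype.card ι * μ ^ 2 * s * B := by
  have hμ0 : 0 ≤ μ := (norm_nonneg _).trans (hμ l j)
  have h1 : ‖∑ k, star (A l k) * z k‖ ≤ s * (μ * B) := by
    have : ∑ k, star (A l k) * z k = ∑ k ∈ S, star (A l k) * z k := by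
      symm
      apply Finset.sum_subset (Finset.subset_univ _)
      intro k _ hk
      simp [hzS k hk]
    rw [this]
    calc _ ≤ ∑ k ∈ S, μ * B := by
          apply norm_sum_le_of_le
          intro k _
          rw [norm_mul, norm_star]
          exact mul_le_mul (hμ _ _) (hz _) (norm_nonneg _) hμ0
      _ ≤ _ := by
          rw [Finset.sum_const, nsmul_eq_mul]; gcongr
  have hs0 : 0 ≤ s := le_trans (by positivity) hs
  simp only [est, norm_mul, Complex.norm_natCast]
  calc _ ≤ Fintype.card ι * (s * (μ * B)) * μ := by gcongr; exact hμ _ _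
    _ = _ := by ring

lemma est_var {ι : Type*} [Fintype ι] {N : ℕ} (A : Matrix ι (Fin N) ℂ) (hA : Aᴴ * A = 1)
    (μ : ℝ) (hμ : ∀ l j, ‖A l j‖ ≤ μ) (S : Finset (Fin N)) (s : ℝ) (hs : (S.card : ℝ) ≤ s)
    (z : Fin N → ℂ) (B : ℝ) (hB : 0 ≤ B) (hz : ∀ j, ‖z j‖ ≤ B) (hzS : ∀ j ∉ S, z j = 0) (j : Fin N) :
    ∑ l, ‖est A z l j‖ ^ 2 ≤ Fintype.card ι * (Fintype.card ι * μ ^ 2 * s * B ^ 2) := by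
  have hs0 : 0 ≤ s := le_trans (by positivity) hs
  have hzz : ∑ k, ‖z k‖ ^ 2 ≤ s * B ^ 2 := by
    have : ∑ k, ‖z k‖ ^ 2 = ∑ k ∈ S, ‖z k‖ ^ 2 := by
      symm
      apply Finset.sum_subset (Finset.subset_univ _)
      intro k _ hk
      simp [hzS k hk]
    rw [this]
    calc _ ≤ ∑ k ∈ S, B ^ 2 := by
          gcongr with k; exact hz k
      _ ≤ _ := by
          rw [Finset.sum_const, nsmul_eq_mul]; gcongr
  calc _ ≤ ∑ l, (Fintype.card ι : ℝ) ^ 2 * μ ^ 2 * ‖∑ k, star (A l k) * z k‖ ^ 2 := by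
        apply Finset.sum_le_sum
        intro l _
        simp only [est, norm_mul, Complex.norm_natCast, mul_pow]
        have : ‖A l j‖ ^ 2 ≤ μ ^ 2 := by gcongr; exact hμ _ _
        calc _ ≤ (Fintype.card ι : ℝ) ^ 2 * ‖∑ k, star (A l k) * z k‖ ^ 2 * μ ^ 2 := by gcongr
          _ = _ := by ring
    _ = (Fintype.card ι : ℝ) ^ 2 * μ ^ 2 * ∑ k, ‖z k‖ ^ 2 := by
        rw [← Finset.mul_sum, inner_sq A hA]
    _ ≤ (Fintype.card ι : ℝ) ^ 2 * μ ^ 2 * (s * B ^ 2) := by gcongr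
    _ = _ := by ring

/-- one direction -/
lemma dir_count {ι : Type*} [Fintype ι] {N : ℕ} (A : Matrix ι (Fin N) ℂ) (hA : Aᴴ * A = 1)
    (μ : ℝ) (hμ : ∀ l j, ‖A l j‖ ≤ μ) (S : Finset (Fin N)) (s : ℝ) (hs : (S.card : ℝ) ≤ s)
    (κ : ℝ) (hκ : κ = Fintype.card ι * μ ^ 2 * s) (hκ0 : 0 < κ) (b : ℕ)
    (z : Fin N → ℂ) (B : ℝ) (hB : 0 < B) (hz : ∀ j, ‖z j‖ ≤ B) (hzS : ∀ j ∉ S, z j = 0) (j : Fin N)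
    (u : ℂ) (hu : ‖u‖ = 1) :
    (Set.ncard {ω : Fin b → ι | b * ((u * z j).re + B / 8) ≤ ∑ i, (u * est A z (ω i) j).re} : ℝ)
      ≤ (Fintype.card ι : ℝ) ^ b * Real.exp (-(b / (256 * κ))) := by
  have hY : ∀ l, |(u * est A z l j).re| ≤ ‖est A z l j‖ := by
    intro l
    refine (Complex.abs_re_le_norm _).trans ?_
    simp [hu]
  have := chernoff_count b (fun l => (u * est A z l j).re) ((u * z j).re) (B / 8) (κ * B ^ 2)
    (1 / (16 * κ * B)) (by positivity) ?_ ?_ ?_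
  · refine this.trans (le_of_eq ?_)
    congr 2
    field_simp
    ring
  · intro l
    have h1 := (hY l).trans (est_bound A μ hμ S s hs z B hB.le hz hzS l j)
    rw [← hκ] at h1
    rw [abs_mul, abs_of_pos (by positivity), one_div, inv_mul_le_iff₀ (by positivity)]
    have := mul_pos hκ0 hB
    linarith
  · rw [← Complex.re_sum, ← Finset.mul_sum, est_sum A hA]
    rw [mul_left_comm, natCast_mul_re']
  · have := est_var A hA μ hμ S s hs z B hB.le hz hzS j
    rw [← hκ] at this
    refine le_trans ?_ this
    apply Finset.sum_le_sum
    intro l _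
    rw [← sq_abs]
    gcongr
    exact hY l

lemma batch_count {ι : Type*} [Fintype ι] {N : ℕ} (A : Matrix ι (Fin N) ℂ) (hA : Aᴴ * A = 1)
    (μ : ℝ) (hμ : ∀ l j, ‖A l j‖ ≤ μ) (S : Finset (Fin N)) (s : ℝ) (hs : (S.card : ℝ) ≤ s)
    (κ : ℝ) (hκ : κ = Fintype.card ι * μ ^ 2 * s) (hκ0 : 0 < κ) (b : ℕ) (hb : 0 < b)
    (z : Fin N → ℂ) (B : ℝ) (hB : 0 < B) (hz : ∀ j, ‖z j‖ ≤ B) (hzS : ∀ j ∉ S, z j = 0) :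
    (Set.ncard {ω : Fin b → ι | ¬ ∀ j, ‖(b : ℂ)⁻¹ * ∑ i, est A z (ω i) j - z j‖ ≤ B / 4} : ℝ)
      ≤ (Fintype.card ι : ℝ) ^ b * (4 * N * Real.exp (-(b / (256 * κ)))) := by
  classical
  let u : Fin 4 → ℂ := ![1, -1, Complex.I, -Complex.I]
  have hu : ∀ r, ‖u r‖ = 1 := by intro r; fin_cases r <;> simp [u]
  have hb' : (0:ℝ) < b := by exact_mod_cast hb
  have hsub : {ω : Fin b → ι | ¬ ∀ j, ‖(b : ℂ)⁻¹ * ∑ i, est A z (ω i) j - z j‖ ≤ B / 4} ⊆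
      ⋃ p ∈ (Finset.univ : Finset (Fin N × Fin 4)),
        {ω : Fin b → ι | b * ((u p.2 * z p.1).re + B / 8) ≤ ∑ i, (u p.2 * est A z (ω i) p.1).re} := by
    intro ω hω
    simp only [Set.mem_ofPred_eq, not_forall, not_le] at hω
    obtain ⟨j, hj⟩ := hω
    set x := (b : ℂ)⁻¹ * ∑ i, est A z (ω i) j - z j with hx
    have hsum : ∀ r, ∑ i, (u r * est A z (ω i) j).re = b * ((u r * z j).re + (u r * x).re) := by
      intro r
      have hbc : (b : ℂ) ≠ 0 := by exact_mod_cast hb.ne'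
      rw [← Complex.re_sum, ← Finset.mul_sum]
      rw [← Complex.add_re, ← mul_add, ← natCast_mul_re']
      congr 1
      rw [hx]; field_simp; ring
    have : ∃ r, B / 8 ≤ (u r * x).re := by
      by_contra hcon
      push Not at hcon
      have h0 := hcon 0
      have h1 := hcon 1
      have h2 := hcon 2
      have h3 := hcon 3
      simp [u] at h0 h1 h2 h3
      have h4 : |x.re| ≤ B / 8 := abs_le.2 ⟨by linarith, by linarith⟩
      have h5 : |x.im| ≤ B / 8 := abs_le.2 ⟨by linarith, by linarith⟩
      have := Complex.norm_le_abs_re_add_abs_im x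
      linarith
    obtain ⟨r, hr⟩ := this
    simp only [Set.mem_iUnion, Finset.mem_univ, Set.mem_ofPred_eq]
    refine ⟨(j, r), trivial, ?_⟩
    rw [hsum]
    gcongr
  have h1 := Set.ncard_le_ncard hsub (Set.toFinite _)
  have h2 := Finset.set_ncard_biUnion_le (Finset.univ : Finset (Fin N × Fin 4)) (fun p =>
        {ω : Fin b → ι | b * ((u p.2 * z p.1).re + B / 8) ≤ ∑ i, (u p.2 * est A z (ω i) p.1).re})
  have h3 : (Set.ncard {ω : Fin b → ι | ¬ ∀ j, ‖(b : ℂ)⁻¹ * ∑ i, est A z (ω i) j - z j‖ ≤ B / 4} : ℝ)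
     ≤ ∑ p : Fin N × Fin 4, (Set.ncard {ω : Fin b → ι | b * ((u p.2 * z p.1).re + B / 8) ≤ ∑ i, (u p.2 * est A z (ω i) p.1).re} : ℝ) := by
    exact_mod_cast h1.trans h2
  refine h3.trans ?_
  calc _ ≤ ∑ p : Fin N × Fin 4, (Fintype.card ι : ℝ) ^ b * Real.exp (-(b / (256 * κ))) := by
        apply Finset.sum_le_sum
        intro p _
        exact dir_count A hA μ hμ S s hs κ hκ hκ0 b z B hB hz hzS p.1 (u p.2) (hu _)
    _ = _ := by simp; ring

open Classical in
lemma ncard_sum {β : Type*} [Fintype β] (Q : β → Prop) :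
    Set.ncard {x | Q x} = ∑ x, if Q x then 1 else 0 := by
  rw [Finset.sum_boole, Set.ncard_eq_toFinset_card']
  simp

lemma ncard_cons {α : Type*} [Fintype α] (M : ℕ) (P : (Fin (M + 1) → α) → Prop) :
    Set.ncard {ω | P ω} = ∑ a, Set.ncard {ω' : Fin M → α | P (Fin.cons a ω')} := by
  classical
  simp only [ncard_sum]
  rw [← Fintype.sum_prod_type']
  exact (Fintype.sum_equiv (Fin.consEquiv (fun _ => α)) _ _ (fun x => rfl)).symm

lemma golf {ι : Type*} [Fintype ι] {N : ℕ} (A : Matrix ι (Fin N) ℂ) (hA : Aᴴ * A = 1)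
    (μ : ℝ) (hμ : ∀ l j, ‖A l j‖ ≤ μ) (S : Finset (Fin N)) (s : ℝ) (hs : (S.card : ℝ) ≤ s)
    (κ : ℝ) (hκ : κ = Fintype.card ι * μ ^ 2 * s) (hκ0 : 0 < κ) (b : ℕ) (hb : 0 < b)
    (q : ℝ) (hq0 : 0 < q) (hq1 : q ≤ 1) (hq : 4 * N * Real.exp (-(b / (256 * κ))) ≤ q) (M : ℕ) :
    ∀ (L : ℕ) (z : Fin N → ℂ) (B : ℝ), 0 < B → (∀ j, ‖z j‖ ≤ B) → (∀ j ∉ S, z j = 0) →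
    (Set.ncard {ω : Fin M → Fin b → ι | ¬ CertOK A S L B z {l | ∃ i k, ω i k = l}} : ℝ)
      ≤ ((Fintype.card ι : ℝ) ^ b) ^ M * (2 ^ M * q ^ M * q⁻¹ ^ L) := by
  classical
  set n : ℝ := (Fintype.card ι : ℝ) with hn
  have zeroL : ∀ (z : Fin N → ℂ) (B : ℝ) (T : Set ι), 0 < B → (∀ j, ‖z j‖ ≤ B) → CertOK A S 0 B z T := by
    intro z B T hB hz
    refine ⟨0, Submodule.zero_mem _, ?_, ?_⟩
    · intro j _; simpa using hz j
    · intro j _; simp; positivity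
  induction M with
  | zero =>
    intro L z B hB hz hzS
    have h1 : Set.ncard {ω : Fin 0 → Fin b → ι | ¬ CertOK A S L B z {l | ∃ i k, ω i k = l}} ≤ 1 := by
      rw [Set.ncard_le_one_iff]
      intro a b _ _
      exact Subsingleton.elim _ _
    have h2 : (1:ℝ) ≤ q⁻¹ ^ L := one_le_pow₀ ((one_le_inv₀ hq0).2 hq1)
    have h1' : (Set.ncard {ω : Fin 0 → Fin b → ι | ¬ CertOK A S L B z {l | ∃ i k, ω i k = l}} : ℝ) ≤ 1 := by
      exact_mod_cast h1
    simpa using h1'.trans h2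
  | succ M ih =>
    intro L z B hB hz hzS
    rcases L with _ | L
    · have : {ω : Fin (M+1) → Fin b → ι | ¬ CertOK A S 0 B z {l | ∃ i k, ω i k = l}} = ∅ := by
        ext ω
        simp [zeroL z B _ hB hz]
      rw [this]
      simp
      positivity
    rw [ncard_cons]
    push_cast
    set G : (Fin b → ι) → Prop := fun a => ∀ j, ‖(b : ℂ)⁻¹ * ∑ i, est A z (a i) j - z j‖ ≤ B / 4 with hG
    have hbad := batch_count A hA μ hμ S s hs κ hκ hκ0 b hb z B hB hz hzS
    have hbad' : (∑ a : Fin b → ι, if ¬ G a then (1:ℝ) else 0) ≤ n ^ b * q := by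
      have : (∑ a : Fin b → ι, if ¬ G a then (1:ℝ) else 0) = Set.ncard {a | ¬ G a} := by
        rw [Finset.sum_boole, Set.ncard_eq_toFinset_card']
        simp
      rw [this]
      refine hbad.trans ?_
      gcongr
    have hterm : ∀ a : Fin b → ι,
        (Set.ncard {ω' : Fin M → Fin b → ι | ¬ CertOK A S (L+1) B z {l | ∃ i k, (Fin.cons a ω' : Fin (M+1) → Fin b → ι) i k = l}} : ℝ)
        ≤ (n ^ b) ^ M * (2 ^ M * q ^ M * q⁻¹ ^ L) +
          (n ^ b) ^ M * (2 ^ M * q ^ M * q⁻¹ ^ (L+1)) * (if ¬ G a then (1:ℝ) else 0) := by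
      intro a
      by_cases hGa : G a
      · simp only [hGa, not_true, if_false, mul_zero, add_zero]
        let g : Fin N → ℂ := fun j => (b : ℂ)⁻¹ * ∑ i, est A z (a i) j
        let z' : Fin N → ℂ := fun j => if j ∈ S then z j - g j else 0
        have hz' : ∀ j, ‖z' j‖ ≤ B / 4 := by
          intro j
          simp only [z']
          split_ifs
          · rw [norm_sub_rev]; exact hGa j
          · simp; positivity
        refine le_trans ?_ (ih L z' (B/4) (by positivity) hz' (fun j hj => by simp [z', hj]))
        gcongr
        · exact Set.toFinite _
        rename_i ω'
        intro hc
        obtain ⟨v, hv, h1, h2⟩ := hc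
        refine ⟨g + v, Submodule.add_mem _ ?_ ?_, ?_, ?_⟩
        · have : g = ∑ i, ((b:ℂ)⁻¹ * ((Fintype.card ι : ℂ) * (∑ k, star (A (a i) k) * z k))) • A (a i) := by
            ext j
            simp only [g, est, Finset.sum_apply, Pi.smul_apply, smul_eq_mul]
            rw [Finset.mul_sum]
            exact Finset.sum_congr rfl fun i _ => by ring
          rw [this]
          refine Submodule.sum_mem _ fun i _ => Submodule.smul_mem _ _ (Submodule.subset_span ?_)
          exact ⟨a i, ⟨0, i, rfl⟩, rfl⟩
        · refine Submodule.span_mono (Set.image_mono ?_) hv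
          rintro l ⟨i, k, h⟩
          exact ⟨i.succ, k, by simpa using h⟩
        · intro j hj
          have := h1 j hj
          simp only [z', hj, if_true] at this
          calc _ = ‖v j - (z j - g j)‖ := by congr 1; simp only [Pi.add_apply]; ring
            _ ≤ _ := this
            _ = _ := by rw [pow_succ]; field_simp
        · intro j hj
          have h3 := h2 j hj
          have h4 := hGa j
          rw [hzS j hj, sub_zero] at h4
          have := norm_add_le (g j) (v j)
          simp only [Pi.add_apply]
          have h5 : ‖g j‖ ≤ B / 4 := h4
          linarith
      · simp only [hGa, not_false_iff, if_true, mul_one]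
        refine le_trans ?_ ((ih (L+1) z B hB hz hzS).trans (le_add_of_nonneg_left (by positivity)))
        gcongr
        · exact Set.toFinite _
        rename_i ω'
        intro hc
        refine hc.mono ?_
        rintro l ⟨i, k, h⟩
        exact ⟨i.succ, k, by simpa using h⟩
    refine (Finset.sum_le_sum fun a _ => hterm a).trans ?_
    rw [Finset.sum_add_distrib]
    have hc : ∑ a : Fin b → ι, (n ^ b) ^ M * (2 ^ M * q ^ M * q⁻¹ ^ L) = n ^ b * ((n ^ b) ^ M * (2 ^ M * q ^ M * q⁻¹ ^ L)) := by
      simp [hn]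
    rw [hc, ← Finset.mul_sum]
    calc _ ≤ n ^ b * ((n ^ b) ^ M * (2 ^ M * q ^ M * q⁻¹ ^ L)) +
          (n ^ b) ^ M * (2 ^ M * q ^ M * q⁻¹ ^ (L+1)) * (n ^ b * q) := by gcongr
      _ = _ := by
        simp only [pow_succ]
        field_simp
        ring

lemma transfer {ι : Type*} [Fintype ι] (m M b : ℕ) (hm : M * b ≤ m) (P : Set ι → Prop)
    (hP : ∀ T T', T ⊆ T' → P T → P T') :
    Set.ncard {ω : Fin m → ι | ¬ P (Set.range ω)} ≤
      Set.ncard {ω : Fin M → Fin b → ι | ¬ P {l | ∃ i k, ω i k = l}} * Fintype.card ι ^ (m - M * b) := by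
  classical
  let e : Fin m ≃ (Fin M × Fin b) ⊕ Fin (m - M * b) := Fintype.equivOfCardEq (by simp; omega)
  let Φ : (Fin m → ι) → (Fin M → Fin b → ι) × (Fin (m - M * b) → ι) := fun ω =>
    (fun i k => ω (e.symm (Sum.inl (i, k))), fun r => ω (e.symm (Sum.inr r)))
  have hΦ : Function.Injective Φ := by
    intro ω ω' h
    ext x
    obtain ⟨y, rfl⟩ := e.symm.surjective x
    rcases y with ⟨i, k⟩ | r
    · exact congrFun (congrFun (congrArg Prod.fst h) i) k
    · exact congrFun (congrArg Prod.snd h) r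
  have : Set.ncard ({ω : Fin M → Fin b → ι | ¬ P {l | ∃ i k, ω i k = l}} ×ˢ (Set.univ : Set (Fin (m - M * b) → ι))) =
      Set.ncard {ω : Fin M → Fin b → ι | ¬ P {l | ∃ i k, ω i k = l}} * Fintype.card ι ^ (m - M * b) := by
    rw [Set.ncard_prod, Set.ncard_univ]
    simp
  rw [← this]
  refine Set.ncard_le_ncard_of_injOn Φ ?_ hΦ.injOn (Set.toFinite _)
  intro ω hω
  refine ⟨?_, trivial⟩
  intro hc
  apply hω
  refine hP _ _ ?_ hc
  rintro l ⟨i, k, h⟩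
  exact ⟨_, h⟩

lemma pair_zero {ι : Type*} {N : ℕ} (A : Matrix ι (Fin N) ℂ) (T : Set ι) (h : Fin N → ℂ)
    (hh : ∀ l ∈ T, ∑ j, A l j * h j = 0) (v : Fin N → ℂ) (hv : v ∈ Submodule.span ℂ (A '' T)) :
    ∑ j, v j * h j = 0 := by
  induction hv using Submodule.span_induction with
  | mem x hx => obtain ⟨l, hl, rfl⟩ := hx; exact hh l hl
  | zero => simp
  | add x y _ _ hx hy => simp [add_mul, Finset.sum_add_distrib, hx, hy]
  | smul a x _ hx => simp [mul_assoc, ← Finset.mul_sum, hx]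

/-- bound on the pairing of the target with a kernel vector -/
lemma pair_bound {ι : Type*} {N : ℕ} (A : Matrix ι (Fin N) ℂ) (S : Finset (Fin N)) (L : ℕ)
    (z : Fin N → ℂ) (hzS : ∀ j ∉ S, z j = 0) (T : Set ι) (hc : CertOK A S L 1 z T) (h : Fin N → ℂ)
    (hh : ∀ l ∈ T, ∑ j, A l j * h j = 0) :
    ‖∑ j, z j * h j‖ ≤ (∑ j ∈ S, ‖h j‖) / 4 ^ L + (∑ j ∈ Sᶜ, ‖h j‖) / 3 := by
  obtain ⟨v, hv, h1, h2⟩ := hc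
  have h0 := pair_zero A T h hh v hv
  have : ∑ j, z j * h j = ∑ j, (z j - v j) * h j := by
    simp [sub_mul, Finset.sum_sub_distrib, h0]
  rw [this]
  refine (norm_sum_le _ _).trans ?_
  rw [← Finset.sum_add_sum_compl S, Finset.sum_div, Finset.sum_div]
  gcongr with j hj j hj
  · rw [norm_mul, norm_sub_rev]
    have := mul_le_mul_of_nonneg_right (h1 j hj) (norm_nonneg (h j))
    calc _ ≤ _ := this
      _ = _ := by ring
  · have hj' : j ∉ S := by simpa using hj
    rw [hzS j hj', zero_sub, norm_mul, norm_neg]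
    have := mul_le_mul_of_nonneg_right (h2 j hj') (norm_nonneg (h j))
    calc _ ≤ _ := this
      _ = _ := by ring

/-- conjugate sign -/
noncomputable def csgn {N : ℕ} (α : Fin N → ℂ) : Fin N → ℂ := fun j => star (α j) / (‖α j‖ : ℂ)

lemma csgn_norm {N : ℕ} (α : Fin N → ℂ) (j) : ‖csgn α j‖ ≤ 1 := by
  simp [csgn, div_self_le_one]

lemma csgn_mul {N : ℕ} (α : Fin N → ℂ) (j) : csgn α j * α j = (‖α j‖ : ℂ) := by
  by_cases h : α j = 0
  · simp [h]
  · have : (‖α j‖ : ℂ) ≠ 0 := by simpa using h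
    simp only [csgn]
    field_simp
    have := Complex.conj_mul' (α j)
    simpa using this

lemma recover {ι : Type*} {N : ℕ} (A : Matrix ι (Fin N) ℂ) (S : Finset (Fin N)) (L : ℕ)
    (hL : 2 * (S.card : ℝ) ≤ 4 ^ L) (α : Fin N → ℂ) (hα : ∀ j ∉ S, α j = 0) (T : Set ι)
    (h1 : CertOK A S L 1 (csgn α) T) (h2 : ∀ j ∈ S, CertOK A S L 1 (Pi.single j 1) T)
    (β : Fin N → ℂ) (hβ : ∀ l ∈ T, A.mulVec β l = A.mulVec α l) (hne : β ≠ α) :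
    ∑ i, ‖α i‖ < ∑ i, ‖β i‖ := by
  classical
  set h : Fin N → ℂ := β - α with hh
  have hker : ∀ l ∈ T, ∑ j, A l j * h j = 0 := by
    intro l hl
    have := hβ l hl
    simp only [Matrix.mulVec, dotProduct] at this
    simp [hh, mul_sub, Finset.sum_sub_distrib, this]
  set a := ∑ j ∈ S, ‖h j‖ with ha
  set c := ∑ j ∈ Sᶜ, ‖h j‖ with hc
  have ha0 : 0 ≤ a := Finset.sum_nonneg fun _ _ => norm_nonneg _
  have hc0 : 0 ≤ c := Finset.sum_nonneg fun _ _ => norm_nonneg _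
  have h4 : (0:ℝ) < 4 ^ L := by positivity
  have hj : ∀ j ∈ S, ‖h j‖ ≤ a / 4 ^ L + c / 3 := by
    intro j hj
    have := pair_bound A S L (Pi.single j 1) (fun k hk => by
      rw [Pi.single_eq_of_ne]; rintro rfl; exact hk hj) T (h2 j hj) h hker
    simpa [Pi.single_apply] using this
  have hsum : a ≤ S.card * (a / 4 ^ L + c / 3) := by
    calc a ≤ ∑ j ∈ S, (a / 4 ^ L + c / 3) := Finset.sum_le_sum hj
      _ = _ := by rw [Finset.sum_const, nsmul_eq_mul]
  have hd : S.card * (a / 4 ^ L) ≤ a / 2 := by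
    rw [← mul_div_assoc, div_le_div_iff₀ h4 (by norm_num)]
    nlinarith
  have hac : a ≤ 2 / 3 * S.card * c := by nlinarith
  have hcpos : 0 < c := by
    rcases hc0.lt_or_eq with h' | h'
    · exact h'
    exfalso
    have ha' : a = 0 := le_antisymm (by rw [← h'] at hac; simpa using hac) ha0
    apply hne
    have : ∑ j, ‖h j‖ = 0 := by rw [← Finset.sum_add_sum_compl S, ← ha, ← hc, ha', ← h', add_zero]
    rw [Finset.sum_eq_zero_iff_of_nonneg (fun _ _ => norm_nonneg _)] at this
    ext j
    have := this j (Finset.mem_univ _)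
    rw [norm_eq_zero] at this
    exact sub_eq_zero.1 this
  have hz0 : ∀ j ∉ S, csgn α j = 0 := fun j hj => by simp [csgn, hα j hj]
  have hp := pair_bound A S L (csgn α) hz0 T h1 h hker
  have hre := (abs_le.1 ((Complex.abs_re_le_norm _).trans hp)).1
  have hda : a / 4 ^ L ≤ c / 3 := by
    rw [div_le_div_iff₀ h4 (by norm_num)]
    nlinarith
  have hS : ∑ j ∈ S, ‖α j‖ + (∑ j, csgn α j * h j).re ≤ ∑ j ∈ S, ‖β j‖ := by
    have e1 : ∑ j, csgn α j * h j = ∑ j ∈ S, csgn α j * h j := by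
      symm
      apply Finset.sum_subset (Finset.subset_univ _)
      intro j _ hj
      simp [hz0 j hj]
    rw [e1, Complex.re_sum, ← Finset.sum_add_distrib]
    apply Finset.sum_le_sum
    intro j _
    have e2 : csgn α j * β j = (‖α j‖ : ℂ) + csgn α j * h j := by
      rw [← csgn_mul]; simp [hh]; ring
    have e3 : ‖α j‖ + (csgn α j * h j).re = (csgn α j * β j).re := by
      rw [e2]; simp
    rw [e3]
    refine (Complex.re_le_norm _).trans ?_
    rw [norm_mul]
    exact mul_le_of_le_one_left (norm_nonneg _) (csgn_norm α j)
  have hSc : ∑ j ∈ Sᶜ, ‖β j‖ = c := by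
    apply Finset.sum_congr rfl
    intro j hj
    have hj' : j ∉ S := by simpa using hj
    simp [hh, hα j hj']
  have hSa : ∑ j ∈ Sᶜ, ‖α j‖ = 0 := by
    apply Finset.sum_eq_zero
    intro j hj
    have hj' : j ∉ S := by simpa using hj
    simp [hα j hj']
  rw [← Finset.sum_add_sum_compl S, ← Finset.sum_add_sum_compl S, hSc, hSa]
  linarith

lemma main_count {Nw N : ℕ} (A : Matrix (Fin Nw) (Fin N) ℂ) (hA : Aᴴ * A = 1)
    (μ : ℝ) (hμ : ∀ l j, ‖A l j‖ ≤ μ) (S : Finset (Fin N)) (s : ℝ) (hs : (S.card : ℝ) ≤ s)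
    (κ : ℝ) (hκ : κ = Nw * μ ^ 2 * s) (hκ0 : 0 < κ) (b : ℕ) (hb : 0 < b)
    (q : ℝ) (hq0 : 0 < q) (hq1 : q ≤ 1) (hq : 4 * N * Real.exp (-(b / (256 * κ))) ≤ q) (M L m : ℕ)
    (hm : M * b ≤ m) (hL : 2 * (S.card : ℝ) ≤ 4 ^ L) (α : Fin N → ℂ) (hα : ∀ j ∉ S, α j = 0) :
    (Set.ncard {ω : Fin m → Fin Nw | ¬ ∀ β : Fin N → ℂ, (∀ i, A.mulVec β (ω i) = A.mulVec α (ω i)) →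
      β ≠ α → ∑ i, ‖α i‖ < ∑ i, ‖β i‖} : ℝ) ≤ (Nw : ℝ) ^ m * ((N + 1) * (2 ^ M * q ^ M * q⁻¹ ^ L)) := by
  classical
  let tgt : Option (Fin N) → Fin N → ℂ := fun o => o.elim (csgn α) (fun j => if j ∈ S then Pi.single j 1 else 0)
  have ht1 : ∀ o j, ‖tgt o j‖ ≤ 1 := by
    rintro (_ | k) j
    · exact csgn_norm α j
    · simp only [tgt, Option.elim]
      split_ifs
      · rw [Pi.single_apply]; split_ifs <;> simp
      · simp
  have ht2 : ∀ o, ∀ j ∉ S, tgt o j = 0 := by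
    rintro (_ | k) j hj
    · simp [tgt, csgn, hα j hj]
    · simp only [tgt, Option.elim]
      split_ifs with h
      · rw [Pi.single_eq_of_ne]; rintro rfl; exact hj h
      · simp
  have hsub : {ω : Fin m → Fin Nw | ¬ ∀ β : Fin N → ℂ, (∀ i, A.mulVec β (ω i) = A.mulVec α (ω i)) →
      β ≠ α → ∑ i, ‖α i‖ < ∑ i, ‖β i‖} ⊆ ⋃ o ∈ (Finset.univ : Finset (Option (Fin N))),
        {ω : Fin m → Fin Nw | ¬ CertOK A S L 1 (tgt o) (Set.range ω)} := by
    intro ω hω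
    by_contra hcon
    simp only [Set.mem_iUnion, Finset.mem_univ, Set.mem_ofPred_eq, exists_prop, true_and, not_exists, not_not] at hcon
    apply hω
    intro β hβ hne
    refine recover A S L hL α hα (Set.range ω) (hcon none) ?_ β ?_ hne
    · intro j hj
      have := hcon (some j)
      simpa [tgt, hj] using this
    · rintro _ ⟨i, rfl⟩
      exact hβ i
  have h1 := (Set.ncard_le_ncard hsub (Set.toFinite _)).trans (Finset.set_ncard_biUnion_le _ _)
  have h2 : ∀ o, (Set.ncard {ω : Fin m → Fin Nw | ¬ CertOK A S L 1 (tgt o) (Set.range ω)} : ℝ) ≤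
      (Nw : ℝ) ^ m * (2 ^ M * q ^ M * q⁻¹ ^ L) := by
    intro o
    have t1 := transfer m M b hm (fun T => CertOK A S L 1 (tgt o) T) (fun T T' h hc => hc.mono h)
    have t2 := golf A hA μ hμ S s hs κ (by simpa using hκ) hκ0 b hb q hq0 hq1 hq M L (tgt o) 1 one_pos (ht1 o) (ht2 o)
    have t1' : (Set.ncard {ω : Fin m → Fin Nw | ¬ CertOK A S L 1 (tgt o) (Set.range ω)} : ℝ) ≤
      Set.ncard {ω : Fin M → Fin b → Fin Nw | ¬ CertOK A S L 1 (tgt o) {l | ∃ i k, ω i k = l}} * (Fintype.card (Fin Nw) : ℝ) ^ (m - M * b) := by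
      exact_mod_cast t1
    refine t1'.trans ?_
    calc _ ≤ ((Fintype.card (Fin Nw) : ℝ) ^ b) ^ M * (2 ^ M * q ^ M * q⁻¹ ^ L) * (Fintype.card (Fin Nw) : ℝ) ^ (m - M * b) := by gcongr
      _ = (Nw : ℝ) ^ (b * M + (m - M * b)) * (2 ^ M * q ^ M * q⁻¹ ^ L) := by
        rw [Fintype.card_fin, pow_add, pow_mul]; ring
      _ = _ := by
        congr 2
        rw [mul_comm b M]; omega
  calc _ ≤ ∑ o : Option (Fin N), (Set.ncard {ω : Fin m → Fin Nw | ¬ CertOK A S L 1 (tgt o) (Set.range ω)} : ℝ) := by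
        exact_mod_cast h1
    _ ≤ ∑ o : Option (Fin N), (Nw : ℝ) ^ m * (2 ^ M * q ^ M * q⁻¹ ^ L) := Finset.sum_le_sum fun o _ => h2 o
    _ = _ := by simp; ring

lemma numerics (N : ℕ) (hN : 2 ≤ N) (M L : ℕ) (hM : 30 * Real.log N ^ 3 ≤ M)
    (hL : (L : ℝ) ≤ Real.log N + 2) :
    ((N : ℝ) + 1) * (2 ^ M * Real.exp (-(2 * Real.log N)) ^ M * (Real.exp (-(2 * Real.log N)))⁻¹ ^ L)
      ≤ (N : ℝ) ^ (-(2 * Real.log N ^ 3)) := by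
  have hN' : (2:ℝ) ≤ N := by exact_mod_cast hN
  have hN0 : (0:ℝ) < N := by linarith
  have hl2 : Real.log 2 ≤ Real.log N := Real.log_le_log (by norm_num) hN'
  have hl : 0.69 ≤ Real.log N := by have := Real.log_two_gt_d9; linarith
  have hNe : (N : ℝ) = Real.exp (Real.log N) := (Real.exp_log hN0).symm
  rw [Real.rpow_def_of_pos hN0]
  set l := Real.log N with hldef
  have e1 : (N : ℝ) + 1 ≤ Real.exp (2 * l) := by
    rw [two_mul, Real.exp_add, ← hNe]; nlinarith
  have e2 : (2:ℝ) ^ M ≤ Real.exp (M * l) := by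
    rw [Real.exp_nat_mul, ← hNe]; gcongr
  rw [← Real.exp_neg, ← Real.exp_nat_mul, ← Real.exp_nat_mul, neg_neg]
  calc _ ≤ Real.exp (2 * l) * (Real.exp (M * l) * Real.exp (M * (-(2 * l))) * Real.exp (L * (2 * l))) := by
        gcongr
    _ = Real.exp (2 * l + (M * l + M * (-(2 * l)) + L * (2 * l))) := by
        simp only [Real.exp_add]
    _ ≤ _ := by
        apply Real.exp_le_exp.2
        have hl0 : 0 ≤ l := by linarith
        have a1 : 0.47 * l ≤ l ^ 3 := by
          have : 0.47 ≤ l ^ 2 := by nlinarith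
          nlinarith
        have a2 : 0.32 ≤ l ^ 3 := by nlinarith
        have a3 : (M : ℝ) - 2 * L - 2 ≥ 2 * l ^ 3 := by linarith
        nlinarith

lemma core {Nw N m s : ℕ} (hN : 2 ≤ N) (hNw : N ≤ Nw) (hs0 : 0 < s) (A : Matrix (Fin Nw) (Fin N) ℂ)
    (hA : Aᴴ * A = 1) (μ : ℝ) (hμ : ∀ l j, ‖A l j‖ ≤ μ) (α : Fin N → ℂ)
    (hα : {i | α i ≠ 0}.ncard ≤ s) (hm : (m : ℝ) ≥ 87040 * Nw * μ ^ 2 * s * Real.log N ^ 4) :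
    (Set.ncard {ω : Fin m → Fin Nw | ¬ ∀ β : Fin N → ℂ, (∀ i, A.mulVec β (ω i) = A.mulVec α (ω i)) →
      β ≠ α → ∑ i, ‖α i‖ < ∑ i, ‖β i‖} : ℝ) ≤ (Nw : ℝ) ^ m * (N : ℝ) ^ (-(2 * Real.log N ^ 3)) := by
  classical
  have hN' : (2:ℝ) ≤ N := by exact_mod_cast hN
  have hN0 : (0:ℝ) < N := by linarith
  have hl2 : Real.log 2 ≤ Real.log N := Real.log_le_log (by norm_num) hN'
  have hl : 0.69 ≤ Real.log N := by have := Real.log_two_gt_d9; linarith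
  have hNe : (N : ℝ) = Real.exp (Real.log N) := (Real.exp_log hN0).symm
  set S : Finset (Fin N) := Finset.univ.filter (fun i => α i ≠ 0) with hS
  have hSc : (S.card : ℝ) ≤ s := by
    have : {i | α i ≠ 0}.ncard = S.card := by
      rw [Set.ncard_eq_toFinset_card']; simp [hS]
    rw [this] at hα
    exact_mod_cast hα
  have hSN : (S.card : ℝ) ≤ N := by
    have := Finset.card_le_univ S
    rw [Fintype.card_fin] at this
    exact_mod_cast this
  set κ : ℝ := Nw * μ ^ 2 * s with hκ
  have hs1 : (1:ℝ) ≤ s := by exact_mod_cast hs0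
  have hκ1 : 1 ≤ κ := by
    have j : Fin N := ⟨0, by omega⟩
    have h1 : ∑ l, ‖A l j‖ ^ 2 = 1 := by
      have := congrFun (congrFun hA j) j
      simp only [Matrix.mul_apply, Matrix.conjTranspose_apply, Matrix.one_apply_eq] at this
      have h2 : ((∑ l, ‖A l j‖ ^ 2 : ℝ) : ℂ) = 1 := by
        push_cast
        simp only [← Complex.conj_mul']
        exact this
      exact_mod_cast h2
    have h2 : ∑ l, ‖A l j‖ ^ 2 ≤ Nw * μ ^ 2 := by
      calc _ ≤ ∑ l : Fin Nw, μ ^ 2 := by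
            gcongr with l; exact hμ l j
        _ = _ := by simp
    rw [h1] at h2
    nlinarith
  have hκ0 : 0 < κ := by linarith
  set l := Real.log N with hldef
  have hl0 : 0 < l := by linarith
  set b : ℕ := ⌈1280 * κ * l⌉₊ with hb
  set M : ℕ := ⌈30 * l ^ 3⌉₊ with hM
  set L : ℕ := ⌈l⌉₊ + 1 with hL
  have hkl : 0.69 ≤ κ * l := by nlinarith
  have hb1 : 1280 * κ * l ≤ b := Nat.le_ceil _
  have hb2 : (b:ℝ) ≤ 2 * (1280 * κ * l) := by
    have := (Nat.ceil_lt_add_one (show 0 ≤ 1280 * κ * l by positivity)).le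
    linarith
  have hM1 : 30 * l ^ 3 ≤ M := Nat.le_ceil _
  have hl3 : 0.32 ≤ l ^ 3 := by
    have : (0.69:ℝ) ^ 3 ≤ l ^ 3 := by gcongr
    norm_num at this ⊢
    linarith
  have hM2 : (M:ℝ) ≤ 34 * l ^ 3 := by
    have := (Nat.ceil_lt_add_one (show 0 ≤ 30 * l ^ 3 by positivity)).le
    linarith
  have hL1 : l + 1 ≤ L := by
    have := Nat.le_ceil l
    rw [hL]; push_cast; linarith
  have hL2 : (L:ℝ) ≤ l + 2 := by
    have := (Nat.ceil_lt_add_one hl0.le).le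
    rw [hL]; push_cast; linarith
  have hb0 : 0 < b := by
    have : (0:ℝ) < b := by linarith
    exact_mod_cast this
  have hmM : M * b ≤ m := by
    have : (M * b : ℝ) ≤ m := by
      calc (M * b : ℝ) ≤ (34 * l ^ 3) * (2 * (1280 * κ * l)) := by gcongr
        _ = 87040 * Nw * μ ^ 2 * s * l ^ 4 := by rw [hκ]; ring
        _ ≤ m := hm
    exact_mod_cast this
  have h4L : 2 * (S.card : ℝ) ≤ 4 ^ L := by
    have h1 : Real.exp (L : ℝ) ≤ 4 ^ L := by
      have : Real.exp (L : ℝ) = Real.exp 1 ^ L := by rw [← Real.exp_nat_mul, mul_one]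
      rw [this]
      have := Real.exp_one_lt_d9
      gcongr
      linarith
    have h2 : Real.exp (l + 1) ≤ Real.exp L := Real.exp_le_exp.2 hL1
    rw [Real.exp_add, ← hNe] at h2
    have := Real.exp_one_gt_d9
    nlinarith
  have hq : 4 * N * Real.exp (-(b / (256 * κ))) ≤ Real.exp (-(2 * l)) := by
    have h1 : 5 * l ≤ b / (256 * κ) := by
      rw [le_div_iff₀ (by positivity)]; linarith
    have h2 : Real.exp (-(b / (256 * κ))) ≤ Real.exp (-(5 * l)) := Real.exp_le_exp.2 (by linarith)
    have h3 : 4 * (N:ℝ) ≤ Real.exp (3 * l) := by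
      have : Real.exp (3 * l) = (N:ℝ) ^ 3 := by
        rw [show 3 * l = (3:ℕ) * l by norm_num, Real.exp_nat_mul, ← hNe]
      rw [this]
      nlinarith [mul_pos hN0 hN0]
    calc _ ≤ Real.exp (3 * l) * Real.exp (-(5 * l)) := by gcongr
      _ = _ := by rw [← Real.exp_add]; congr 1; ring
  have := main_count A hA μ hμ S s hSc κ hκ hκ0 b hb0 (Real.exp (-(2 * l))) (Real.exp_pos _)
    (Real.exp_le_one_iff.2 (by linarith)) hq M L m hmM h4L α (fun j hj => by simpa [hS] using hj)
  refine this.trans ?_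
  gcongr
  exact numerics N hN M L hM1 hL2

/-- Theorem 4 of the paper: recovery in the analog spread spectrum
model. There exist universal constants `C > 0` and `γ > 1` such that: for `N ≤ N_w`,
an up-sampling operator `U` with `U* U = I_N`, a unimodular diagonal modulation
`C = diagonal c`, unitary `F ∈ ℂ^{N_w × N_w}` and `Ψ ∈ ℂ^{N × N}`, analog coherence
`μ_w = max_{i,j} |⟨f_i, C U ψ_j⟩|`, an `s`-sparse `α`, and indices chosen i.i.d.
uniformly from `{1, …, N_w}` (modeled by the uniform probability measure on
`Fin m → Fin N_w`): if `m ≥ C N_w μ_w² s log⁴ N`, then with probability at least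
`1 - N ^ (-γ log³ N)` the vector `α` is the unique minimizer of the `ℓ¹` problem with
data `y = (F* C U Ψ)_Ω α`. -/
theorem statement13 :
    ∃ C > (0 : ℝ), ∃ γ > (1 : ℝ),
      ∀ (N Nw m s : ℕ), N ≤ Nw →
      ∀ (U : Matrix (Fin Nw) (Fin N) ℂ), Uᴴ * U = 1 →
      ∀ (c : Fin Nw → ℂ), (∀ i, ‖c i‖ = 1) →
      ∀ (F : Matrix (Fin Nw) (Fin Nw) ℂ), F ∈ Matrix.unitaryGroup (Fin Nw) ℂ →
      ∀ (Ψ : Matrix (Fin N) (Fin N) ℂ), Ψ ∈ Matrix.unitaryGroup (Fin N) ℂ →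
      ∀ μw : ℝ, μw = ⨆ i : Fin Nw, ⨆ j : Fin N,
          ‖∑ k, (starRingEnd ℂ) (F k i) * (Matrix.diagonal c * U * Ψ) k j‖ →
      ∀ α : Fin N → ℂ, {i | α i ≠ 0}.ncard ≤ s →
      (m : ℝ) ≥ C * Nw * μw ^ 2 * s * Real.log N ^ 4 →
      (((Nw : ℝ≥0∞) ^ m)⁻¹ • Measure.count : Measure (Fin m → Fin Nw))
          {ω | ∀ b : Fin N → ℂ,
            (∀ i, (Fᴴ * Matrix.diagonal c * U * Ψ).mulVec b (ω i)
                = (Fᴴ * Matrix.diagonal c * U * Ψ).mulVec α (ω i)) →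
            b ≠ α → ∑ i, ‖α i‖ < ∑ i, ‖b i‖}
        ≥ ENNReal.ofReal (1 - (N : ℝ) ^ (-(γ * Real.log N ^ 3))) := by
  refine ⟨87040, by norm_num, 2, by norm_num, ?_⟩
  intro N Nw m s hNw U hU c hc F hF Ψ hΨ μw hμw α hα hm
  rcases Nat.lt_or_ge N 2 with hN | hN
  · have : Real.log N = 0 := by interval_cases N <;> simp
    rw [this]
    simp
  set A := Fᴴ * Matrix.diagonal c * U * Ψ with hAdef
  have hF' : F * Fᴴ = 1 := (Matrix.mem_unitaryGroup_iff).1 hF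
  have hΨ' : Ψᴴ * Ψ = 1 := (Matrix.mem_unitaryGroup_iff').1 hΨ
  have hcc : (Matrix.diagonal c)ᴴ * Matrix.diagonal c = 1 := by
    rw [Matrix.diagonal_conjTranspose, Matrix.diagonal_mul_diagonal, ← Matrix.diagonal_one]
    congr 1
    ext i
    have := Complex.conj_mul' (c i)
    simpa [hc i] using this
  have hA : Aᴴ * A = 1 := by
    calc Aᴴ * A = Ψᴴ * (Uᴴ * ((Matrix.diagonal c)ᴴ * (F * Fᴴ) * Matrix.diagonal c) * U) * Ψ := by
          rw [hAdef]
          simp only [Matrix.conjTranspose_mul, Matrix.conjTranspose_conjTranspose, Matrix.mul_assoc]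
      _ = 1 := by
          rw [hF', Matrix.mul_one, hcc, Matrix.mul_one, hU, Matrix.mul_one, hΨ']
  have hAe : ∀ i j, A i j = ∑ k, (starRingEnd ℂ) (F k i) * (Matrix.diagonal c * U * Ψ) k j := by
    intro i j
    have : A = Fᴴ * (Matrix.diagonal c * U * Ψ) := by rw [hAdef]; simp only [Matrix.mul_assoc]
    rw [this, Matrix.mul_apply]
    rfl
  have hμ : ∀ l j, ‖A l j‖ ≤ μw := by
    intro l j
    rw [hμw]
    simp only [← hAe]
    exact (le_ciSup (f := fun j => ‖A l j‖) (Set.finite_range _).bddAbove j).trans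
      (le_ciSup (f := fun l => ⨆ j, ‖A l j‖) (Set.finite_range _).bddAbove l)
  set p : ℝ := (N : ℝ) ^ (-(2 * Real.log N ^ 3)) with hp
  have hp0 : 0 ≤ p := by positivity
  set Good : Set (Fin m → Fin Nw) := {ω | ∀ b : Fin N → ℂ,
    (∀ i, A.mulVec b (ω i) = A.mulVec α (ω i)) → b ≠ α → ∑ i, ‖α i‖ < ∑ i, ‖b i‖} with hGood
  have hbad : (Set.ncard Goodᶜ : ℝ) ≤ (Nw : ℝ) ^ m * p := by
    rcases Nat.eq_zero_or_pos s with hs | hs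
    · have h0 : α = 0 := by
        subst hs
        have : {i | α i ≠ 0} = ∅ := (Set.ncard_eq_zero (Set.toFinite _)).1 (Nat.le_zero.1 hα)
        ext i
        by_contra h
        have h' : i ∈ {i | α i ≠ 0} := h
        rw [this] at h'
        exact h'
      have : Goodᶜ = ∅ := by
        rw [Set.compl_empty_iff, Set.eq_univ_iff_forall]
        intro ω b _ hb
        rw [h0] at hb ⊢
        simp only [Pi.zero_apply, norm_zero, Finset.sum_const_zero]
        obtain ⟨i, hi⟩ := Function.ne_iff.1 hb
        exact Finset.sum_pos' (fun _ _ => norm_nonneg _) ⟨i, Finset.mem_univ _, norm_pos_iff.2 hi⟩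
      rw [this]
      simp only [Set.ncard_empty, Nat.cast_zero]
      positivity
    · exact core hN hNw hs A hA μw hμ α hα hm
  have hNw0 : (0:ℝ) < (Nw : ℝ) ^ m := by
    have : 0 < Nw := by omega
    positivity
  have htot : (Set.ncard Good : ℝ) + Set.ncard Goodᶜ = (Nw : ℝ) ^ m := by
    have := Set.ncard_add_ncard_compl Good (Set.toFinite _) (Set.toFinite _)
    rw [Nat.card_eq_fintype_card] at this
    simp only [Fintype.card_pi, Fintype.card_fin, Finset.prod_const, Finset.card_univ] at this
    exact_mod_cast this
  have hgood : (1 - p) ≤ ((Nw : ℝ) ^ m)⁻¹ * Set.ncard Good := by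
    rw [le_inv_mul_iff₀ hNw0]
    linarith
  rw [ge_iff_le, Measure.smul_apply, Measure.count_apply (Set.toFinite _).measurableSet, smul_eq_mul]
  refine (ENNReal.ofReal_le_ofReal hgood).trans (le_of_eq ?_)
  rw [ENNReal.ofReal_mul (by positivity), ENNReal.ofReal_inv_of_pos hNw0, ENNReal.ofReal_pow (by positivity),
    ENNReal.ofReal_natCast, ENNReal.ofReal_natCast]
  congr 1
  rw [← (Set.toFinite Good).cast_ncard_eq]
  exact (ENat.toENNReal_coe _).symm
end
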